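/- Suppose 𝒱 satisfies the single-well hypotheses. Then there exist δ > 0, λ₀ > 0 and C > 0 such that |g'''(x;λ)| ≤ C holds for all λ ∈ (0, λ₀] and all x with ½·x₋(λ) < x < δ. -/

import Mathlib

open MeasureTheory Set

noncomputable def pdermix (V : ℝ → ℝ → ℝ) (m n : ℕ) (x lam : ℝ) : ℝ :=
  iteratedDeriv m (fun l => iteratedDeriv n (fun x' => V x' l) x) lam

structure SingleWell (V : ℝ → ℝ → ℝ) (lammax δ pp pm Vp Vm : ℝ) : Prop where
  lammax_pos : 0 < lammax
  delta_pos : 0 < δ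
  pp_nonneg : 0 ≤ pp
  pm_nonneg : 0 ≤ pm
  Vp_pos : 0 < Vp
  Vm_pos : 0 < Vm
  smooth : ∀ lam ∈ Icc (0:ℝ) lammax, ContDiff ℝ 5 (fun x => V x lam)
  V_zero : ∀ lam ∈ Icc (0:ℝ) lammax, V 0 lam = 0
  dV_zero : ∀ lam ∈ Icc (0:ℝ) lammax, deriv (fun x => V x lam) 0 = 0
  d2V_pos : ∀ lam ∈ Icc (0:ℝ) lammax, 0 < iteratedDeriv 2 (fun x => V x lam) 0
  dV_pos : ∀ lam ∈ Icc (0:ℝ) lammax, ∀ x : ℝ, 0 < x → 0 < deriv (fun x' => V x' lam) x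
  dV_neg : ∀ lam ∈ Icc (0:ℝ) lammax, ∀ x : ℝ, x < 0 → deriv (fun x' => V x' lam) x < 0
  asympP : ∀ η > (0:ℝ), ∃ X > (0:ℝ), ∀ lam ∈ Icc (0:ℝ) lammax, ∀ x ≥ X,
      |V x lam - Vp * |x| ^ pp| ≤ η * (Vp * |x| ^ pp)
  asympM : ∀ η > (0:ℝ), ∃ X > (0:ℝ), ∀ lam ∈ Icc (0:ℝ) lammax, ∀ x ≤ -X,
      |V x lam - Vm * |x| ^ pm| ≤ η * (Vm * |x| ^ pm)
  derivP : ∃ C > (0:ℝ), ∃ X > (0:ℝ), ∀ lam ∈ Icc (0:ℝ) lammax, ∀ x ≥ X,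
      |deriv (fun x' => V x' lam) x| ≤ C * |x| ^ (pp - 1) ∧
      |iteratedDeriv 2 (fun x' => V x' lam) x| ≤ C * |x| ^ (pp - 2)
  derivM : ∃ C > (0:ℝ), ∃ X > (0:ℝ), ∀ lam ∈ Icc (0:ℝ) lammax, ∀ x ≤ -X,
      |deriv (fun x' => V x' lam) x| ≤ C * |x| ^ (pm - 1) ∧
      |iteratedDeriv 2 (fun x' => V x' lam) x| ≤ C * |x| ^ (pm - 2)
  mixed_cont : ∀ m ≤ 2, ∀ n ≤ 5, ContinuousOn
      (fun p : ℝ × ℝ => pdermix V m n p.1 p.2)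
      (Ioo (-δ) δ ×ˢ Icc (0:ℝ) lammax)

/-- The defining properties of the Langer transformation for potential `W := 𝒱(·;λ) - λ`
(so that the right-hand side of the ODE is `W x`), turning points `xm < xp`, parameter `b < 0`. -/
def IsLanger (W : ℝ → ℝ) (xm xp b : ℝ) (g : ℝ → ℝ) : Prop :=
  Continuous g ∧ StrictMono g ∧
  g xp = 2 * Real.sqrt (-b) ∧ g xm = -(2 * Real.sqrt (-b)) ∧
  ∀ x : ℝ, x ≠ xm → x ≠ xp →
    DifferentiableAt ℝ g x ∧ 0 < deriv g x ∧
    (deriv g x) ^ 2 * ((1/4) * (g x) ^ 2 + b) = W x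

noncomputable def bParam (W : ℝ → ℝ) (xm xp : ℝ) : ℝ :=
  -(1 / Real.pi) * ∫ x in xm..xp, Real.sqrt (-(W x))

/-- The primitive of `√|s² - β²|` vanishing at `0`. -/
noncomputable def actionPrim (β t : ℝ) : ℝ := ∫ s in (0:ℝ)..t, √|s ^ 2 - β ^ 2|

lemma continuous_actionIntegrand (β : ℝ) : Continuous fun s : ℝ => √|s ^ 2 - β ^ 2| := by
  fun_prop

lemma hasDerivAt_actionPrim (β t : ℝ) :
    HasDerivAt (actionPrim β) (√|t ^ 2 - β ^ 2|) t :=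
  intervalIntegral.integral_hasDerivAt_right
    ((continuous_actionIntegrand β).intervalIntegrable _ _)
    ((continuous_actionIntegrand β).stronglyMeasurableAtFilter _ _)
    (continuous_actionIntegrand β).continuousAt

lemma strictMono_actionPrim (β : ℝ) : StrictMono (actionPrim β) := by
  intro a b hab
  have hi : ∀ x y : ℝ, IntervalIntegrable (fun s : ℝ => √|s ^ 2 - β ^ 2|) volume x y :=
    fun x y => (continuous_actionIntegrand β).intervalIntegrable x y
  have hadd := intervalIntegral.integral_add_adjacent_intervals (hi 0 a) (hi a b)
  have hpos : 0 < ∫ s in a..b, √|s ^ 2 - β ^ 2| := by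
    apply intervalIntegral.integral_pos hab (continuous_actionIntegrand β).continuousOn
    · intro x _
      positivity
    · by_contra! h
      have key : ∀ x ∈ Icc a b, x ^ 2 = β ^ 2 := by
        intro x hx
        have h1 := h x hx
        have h2 : √|x ^ 2 - β ^ 2| = 0 := le_antisymm h1 (Real.sqrt_nonneg _)
        rw [Real.sqrt_eq_zero (abs_nonneg _), abs_eq_zero] at h2
        linarith
      have ha := key a ⟨le_rfl, hab.le⟩
      have hb := key b ⟨hab.le, le_rfl⟩
      have hm := key ((a + b) / 2) ⟨by linarith, by linarith⟩
      have : (a - b) ^ 2 = 0 := by nlinarith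
      have : a - b = 0 := by simpa using this
      linarith
  unfold actionPrim
  linarith

/-- If `u'√|u² - β²| ≤ v'√|v² - β²|` (stated for the squares), then
`actionPrim β ∘ v - actionPrim β ∘ u` is monotone. -/
lemma actionPrim_sub_le {β a b : ℝ} {u v u' v' : ℝ → ℝ} (hab : a ≤ b)
    (hu : ContinuousOn u (Icc a b)) (hv : ContinuousOn v (Icc a b))
    (hu' : ∀ z ∈ Ioo a b, HasDerivAt u (u' z) z) (hv' : ∀ z ∈ Ioo a b, HasDerivAt v (v' z) z)
    (hv0 : ∀ z ∈ Ioo a b, 0 ≤ v' z)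
    (h : ∀ z ∈ Ioo a b, u' z ^ 2 * |u z ^ 2 - β ^ 2| ≤ v' z ^ 2 * |v z ^ 2 - β ^ 2|) :
    actionPrim β (v a) - actionPrim β (u a) ≤ actionPrim β (v b) - actionPrim β (u b) := by
  have hc : Continuous (actionPrim β) :=
    continuous_iff_continuousAt.2 fun t => (hasDerivAt_actionPrim β t).continuousAt
  have hd : ∀ z ∈ Ioo a b, HasDerivAt (fun z => actionPrim β (v z) - actionPrim β (u z))
      (√|v z ^ 2 - β ^ 2| * v' z - √|u z ^ 2 - β ^ 2| * u' z) z := fun z hz =>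
    ((hasDerivAt_actionPrim β (v z)).comp z (hv' z hz)).sub
      ((hasDerivAt_actionPrim β (u z)).comp z (hu' z hz))
  have hmono : MonotoneOn (fun z => actionPrim β (v z) - actionPrim β (u z)) (Icc a b) := by
    apply monotoneOn_of_deriv_nonneg (convex_Icc a b)
    · exact (hc.comp_continuousOn hv).sub (hc.comp_continuousOn hu)
    · rw [interior_Icc]
      exact fun z hz => (hd z hz).differentiableAt.differentiableWithinAt
    · rw [interior_Icc]
      intro z hz
      rw [(hd z hz).deriv, sub_nonneg]
      apply le_of_sq_le_sq _ (mul_nonneg (Real.sqrt_nonneg _) (hv0 z hz))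
      rw [mul_pow, mul_pow, Real.sq_sqrt (abs_nonneg _), Real.sq_sqrt (abs_nonneg _)]
      linarith [h z hz]
  exact hmono ⟨le_rfl, hab⟩ ⟨hab, le_rfl⟩ hab

/-- Normalised data for the Langer equation `w'² (w² - β²) = F` on `(-r, r)` with turning points
`±e`, where `F` is a perturbation of `z² - e²` whose third derivative is small at the origin. -/
structure NormalizedLanger (e β r K : ℝ) (w v F F1 F2 F3 : ℝ → ℝ) : Prop where
  e_pos : 0 < e
  e_lt : e < r
  K_nonneg : 0 ≤ K
  small : 10 ^ 7 * (K * r ^ 2) ≤ 1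
  w_cont : Continuous w
  w_mono : StrictMonoOn w (Ioo (-r) r)
  w_right : w e = β
  w_left : w (-e) = -β
  w_deriv : ∀ z ∈ Ioo (-r) r, z ≠ e → z ≠ -e → HasDerivAt w (v z) z
  v_pos : ∀ z ∈ Ioo (-r) r, z ≠ e → z ≠ -e → 0 < v z
  eqn : ∀ z ∈ Ioo (-r) r, z ≠ e → z ≠ -e → v z ^ 2 * (w z ^ 2 - β ^ 2) = F z
  F_deriv : ∀ z ∈ Ioo (-r) r, HasDerivAt F (F1 z) z
  F1_deriv : ∀ z ∈ Ioo (-r) r, HasDerivAt F1 (F2 z) z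
  F2_deriv : ∀ z ∈ Ioo (-r) r, HasDerivAt F2 (F3 z) z
  F_right : F e = 0
  F_left : F (-e) = 0
  F1_bound : ∀ z ∈ Ioo (-r) r, |F1 z - 2 * z| ≤ K * (|z| + e) ^ 3
  F2_bound : ∀ z ∈ Ioo (-r) r, |F2 z - 2| ≤ K * (|z| + e) ^ 2
  F3_bound : ∀ z ∈ Ioo (-r) r, |F3 z| ≤ K * (|z| + e)

namespace NormalizedLanger

variable {e β r K : ℝ} {w v F F1 F2 F3 : ℝ → ℝ}

lemma reflect (h : NormalizedLanger e β r K w v F F1 F2 F3) :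
    NormalizedLanger e β r K (fun z => -w (-z)) (fun z => v (-z)) (fun z => F (-z))
      (fun z => -F1 (-z)) (fun z => F2 (-z)) (fun z => -F3 (-z)) where
  e_pos := h.e_pos
  e_lt := h.e_lt
  K_nonneg := h.K_nonneg
  small := h.small
  w_cont := (h.w_cont.comp continuous_neg).neg
  w_mono := by
    intro a ha b hb hab
    have := h.w_mono (a := -b) (b := -a) ⟨by linarith [hb.2], by linarith [hb.1]⟩
      ⟨by linarith [ha.2], by linarith [ha.1]⟩ (by linarith)
    simpa using this
  w_right := by simp [h.w_left]
  w_left := by simp [h.w_right]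
  w_deriv := by
    intro z hz h1 h2
    have := h.w_deriv (-z) ⟨by linarith [hz.2], by linarith [hz.1]⟩
      (fun h => h2 (by linarith)) (fun h => h1 (by linarith))
    exact (this.comp z (hasDerivAt_neg z)).neg.congr_deriv (by simp)
  v_pos := fun z hz h1 h2 => h.v_pos (-z) ⟨by linarith [hz.2], by linarith [hz.1]⟩
      (fun h => h2 (by linarith)) (fun h => h1 (by linarith))
  eqn := fun z hz h1 h2 => by
    have := h.eqn (-z) ⟨by linarith [hz.2], by linarith [hz.1]⟩
      (fun h => h2 (by linarith)) (fun h => h1 (by linarith))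
    simpa using this
  F_deriv := fun z hz => by
    have := h.F_deriv (-z) ⟨by linarith [hz.2], by linarith [hz.1]⟩
    exact (this.comp z (hasDerivAt_neg z)).congr_deriv (by simp)
  F1_deriv := fun z hz => by
    have := h.F1_deriv (-z) ⟨by linarith [hz.2], by linarith [hz.1]⟩
    exact (this.comp z (hasDerivAt_neg z)).neg.congr_deriv (by simp)
  F2_deriv := fun z hz => by
    have := h.F2_deriv (-z) ⟨by linarith [hz.2], by linarith [hz.1]⟩
    exact (this.comp z (hasDerivAt_neg z)).congr_deriv (by simp)
  F_right := h.F_left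
  F_left := by simp [h.F_right]
  F1_bound := fun z hz => by
    have := h.F1_bound (-z) ⟨by linarith [hz.2], by linarith [hz.1]⟩
    rw [abs_neg] at this
    rw [← abs_neg]
    convert this using 2
    ring
  F2_bound := fun z hz => by
    have := h.F2_bound (-z) ⟨by linarith [hz.2], by linarith [hz.1]⟩
    rwa [abs_neg] at this
  F3_bound := fun z hz => by
    have := h.F3_bound (-z) ⟨by linarith [hz.2], by linarith [hz.1]⟩
    rw [abs_neg] at this
    rwa [abs_neg]

lemma F_bound_inner (h : NormalizedLanger e β r K w v F F1 F2 F3) {z : ℝ} (hz : z ∈ Icc (-e) e) :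
    |F z - (z ^ 2 - e ^ 2)| ≤ 4 * K * e ^ 2 * (e ^ 2 - z ^ 2) := by
  have he := h.e_pos
  have hr := h.e_lt
  have hmem : ∀ y ∈ Icc (-e) e, y ∈ Ioo (-r) r := fun y hy =>
    ⟨by linarith [hy.1], by linarith [hy.2]⟩
  have hF2 : ∀ y ∈ Icc (-e) e, |F2 y - 2| ≤ 4 * K * e ^ 2 := by
    intro y hy
    refine (h.F2_bound y (hmem y hy)).trans ?_
    have : |y| ≤ e := abs_le.2 hy
    have : (|y| + e) ^ 2 ≤ (2 * e) ^ 2 := by gcongr; linarith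
    nlinarith [h.K_nonneg]
  have key : ∀ σ : ℝ, |σ| = 1 → σ * (F z - (z ^ 2 - e ^ 2)) ≤
      4 * K * e ^ 2 * (e ^ 2 - z ^ 2) := by
    intro σ hσ
    have hcv : ConvexOn ℝ (Icc (-e) e)
        (fun y => σ * (F y - (y ^ 2 - e ^ 2)) - 4 * K * e ^ 2 * (e ^ 2 - y ^ 2)) := by
      apply convexOn_of_hasDerivWithinAt2_nonneg (convex_Icc _ _)
        (f' := fun y => σ * (F1 y - 2 * y) - 4 * K * e ^ 2 * (-(2 * y)))
        (f'' := fun y => σ * (F2 y - 2) - 4 * K * e ^ 2 * (-2))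
      · intro y hy
        have := (h.F_deriv y (hmem y hy)).continuousAt.continuousWithinAt (s := Icc (-e) e)
        fun_prop
      · intro y hy
        have hy' := hmem y (interior_subset hy)
        have h1 := (h.F_deriv y hy').sub ((hasDerivAt_pow 2 y).sub_const (e ^ 2))
        have h2 := ((hasDerivAt_pow 2 y).const_sub (e ^ 2)).const_mul (4 * K * e ^ 2)
        exact ((h1.const_mul σ).sub h2).hasDerivWithinAt.congr_deriv (by simp)
      · intro y hy
        have hy' := hmem y (interior_subset hy)
        have h1 := (h.F1_deriv y hy').sub (((hasDerivAt_id' y).const_mul 2))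
        have h2 := (((hasDerivAt_id' y).const_mul 2).neg).const_mul (4 * K * e ^ 2)
        exact ((h1.const_mul σ).sub h2).hasDerivWithinAt.congr_deriv (by simp)
      · intro y hy
        have h1 := hF2 y (interior_subset hy)
        have h2 : |σ * (F2 y - 2)| ≤ 4 * K * e ^ 2 := by rwa [abs_mul, hσ, one_mul]
        have := (abs_le.1 h2).1
        have := mul_nonneg h.K_nonneg (sq_nonneg e)
        linarith
    have := hcv.le_max_of_mem_Icc (x := -e) (y := e) ⟨le_rfl, by linarith⟩
      ⟨by linarith, le_rfl⟩ hz
    simp only [h.F_left, h.F_right] at this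
    norm_num at this
    linarith
  rw [abs_le]
  have h1 := key 1 (by simp)
  have h2 := key (-1) (by simp)
  constructor <;> linarith

lemma F_bound_outer (h : NormalizedLanger e β r K w v F F1 F2 F3) {z : ℝ} (hz : z ∈ Ico e r) :
    |F z - (z ^ 2 - e ^ 2)| ≤ K * (z + e) ^ 2 * (z ^ 2 - e ^ 2) := by
  have he := h.e_pos
  have hd : ∀ y ∈ Icc e z, HasDerivWithinAt (fun y => F y - (y ^ 2 - e ^ 2)) (F1 y - 2 * y)
      (Icc e z) y := fun y hy => by
    have h1 := (h.F_deriv y ⟨by linarith [hy.1, h.e_lt], by linarith [hy.2, hz.2]⟩).sub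
      ((hasDerivAt_pow 2 y).sub_const (e ^ 2))
    exact h1.hasDerivWithinAt.congr_deriv (by simp)
  have hb : ∀ y ∈ Icc e z, ‖F1 y - 2 * y‖ ≤ K * (z + e) ^ 3 := fun y hy => by
    refine (h.F1_bound y ⟨by linarith [hy.1, h.e_lt], by linarith [hy.2, hz.2]⟩).trans ?_
    rw [abs_of_nonneg (by linarith [hy.1])]
    have := h.K_nonneg
    have := hy.1
    have := hy.2
    have : 0 ≤ y + e := by linarith
    gcongr
  have := (convex_Icc e z).norm_image_sub_le_of_norm_hasDerivWithin_le hd hb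
    (⟨le_rfl, hz.1⟩ : e ∈ Icc e z) (⟨hz.1, le_rfl⟩ : z ∈ Icc e z)
  simp only [h.F_right, sub_self, sub_zero, Real.norm_eq_abs] at this
  rw [abs_of_nonneg (by linarith [hz.1] : 0 ≤ z - e)] at this
  linarith

lemma w_sq_lt (h : NormalizedLanger e β r K w v F F1 F2 F3) {z : ℝ} (hz : z ∈ Ioo (-e) e) :
    w z ^ 2 < β ^ 2 := by
  have he := h.e_pos
  have hr := h.e_lt
  have h1 := h.w_mono (a := z) (b := e) ⟨by linarith [hz.1], by linarith [hz.2]⟩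
    ⟨by linarith, by linarith⟩ hz.2
  have h2 := h.w_mono (a := -e) (b := z) ⟨by linarith, by linarith⟩
    ⟨by linarith [hz.1], by linarith [hz.2]⟩ hz.1
  rw [h.w_right] at h1
  rw [h.w_left] at h2
  nlinarith

lemma beta_pos (h : NormalizedLanger e β r K w v F F1 F2 F3) : 0 < β := by
  have he := h.e_pos
  have hr := h.e_lt
  have h1 := h.w_mono (a := -e) (b := e) ⟨by linarith, by linarith⟩
    ⟨by linarith, by linarith⟩ (by linarith)
  rw [h.w_right, h.w_left] at h1
  linarith

lemma lt_w (h : NormalizedLanger e β r K w v F F1 F2 F3) {z : ℝ} (hz : z ∈ Ioo e r) :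
    β < w z := by
  have he := h.e_pos
  have h1 := h.w_mono (a := e) (b := z) ⟨by linarith [hz.1, hz.2], by linarith [hz.1, hz.2]⟩
    ⟨by linarith [hz.1, hz.2], hz.2⟩ hz.1
  rwa [h.w_right] at h1

lemma beta_sq_le (h : NormalizedLanger e β r K w v F F1 F2 F3) :
    β ^ 2 ≤ (1 + 4 * K * e ^ 2) * e ^ 2 := by
  by_contra! hlt
  have he := h.e_pos
  have hr := h.e_lt
  have hβ := h.beta_pos
  have hη : 0 ≤ 4 * K * e ^ 2 := by have := h.K_nonneg; positivity
  set κ := 1 + 4 * K * e ^ 2 with hκ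
  have hκ0 : 0 < κ := by linarith
  have hsq : √κ ^ 2 = κ := Real.sq_sqrt hκ0.le
  have hs0 : 0 < √κ := Real.sqrt_pos.2 hκ0
  have := actionPrim_sub_le (β := β) (a := -e) (b := e) (u := w) (v := fun z => √κ * z)
    (u' := v) (v' := fun _ => √κ) (by linarith) h.w_cont.continuousOn (by fun_prop)
    (fun z hz => h.w_deriv z ⟨by linarith [hz.1], by linarith [hz.2]⟩ hz.2.ne hz.1.ne')
    (fun z _ => by simpa using (hasDerivAt_id z).const_mul (√κ)) (fun z _ => hs0.le) (by
      intro z hz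
      have h1 := h.eqn z ⟨by linarith [hz.1], by linarith [hz.2]⟩ hz.2.ne hz.1.ne'
      have h2 := h.F_bound_inner ⟨hz.1.le, hz.2.le⟩
      have h3 := h.w_sq_lt hz
      have hze : z ^ 2 < e ^ 2 := by nlinarith [hz.1, hz.2]
      rw [abs_of_neg (by linarith : w z ^ 2 - β ^ 2 < 0), mul_pow, hsq]
      rw [abs_of_neg (by nlinarith : κ * z ^ 2 - β ^ 2 < 0)]
      have h4 := (abs_le.1 h2).1
      have h5 : κ * (κ * e ^ 2 - κ * z ^ 2) ≤ κ * (-(κ * z ^ 2 - β ^ 2)) := by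
        apply mul_le_mul_of_nonneg_left _ hκ0.le
        linarith
      have h6 : 0 ≤ (κ - 1) * (κ * (e ^ 2 - z ^ 2)) := by
        apply mul_nonneg (by linarith) (mul_nonneg hκ0.le (by linarith))
      have h7 : -F z ≤ κ * (e ^ 2 - z ^ 2) := by rw [hκ]; linarith
      linarith)
  have hlt' : √κ * e < β := by
    apply lt_of_pow_lt_pow_left₀ 2 hβ.le
    rw [mul_pow, hsq]
    exact hlt
  have h1 := strictMono_actionPrim β hlt'
  have h2 := strictMono_actionPrim β (by linarith : -β < √κ * -e)
  rw [h.w_left, h.w_right] at this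
  linarith

lemma le_beta_sq (h : NormalizedLanger e β r K w v F F1 F2 F3) :
    (1 - 4 * K * e ^ 2) * e ^ 2 ≤ β ^ 2 := by
  by_contra! hlt
  have he := h.e_pos
  have hr := h.e_lt
  have hβ := h.beta_pos
  have hη : 0 ≤ 4 * K * e ^ 2 := by have := h.K_nonneg; positivity
  set κ := 1 - 4 * K * e ^ 2 with hκ
  have hκ0 : 0 < κ := by
    by_contra! hc
    nlinarith [sq_nonneg e, sq_pos_of_pos hβ]
  have hsq : √κ ^ 2 = κ := Real.sq_sqrt hκ0.le
  have hs0 : 0 < √κ := Real.sqrt_pos.2 hκ0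
  set t := β / √κ with ht
  have ht0 : 0 < t := by positivity
  have htκ : √κ * t = β := by rw [ht]; field_simp
  have hte : t < e := by
    rw [ht, div_lt_iff₀ hs0]
    apply lt_of_pow_lt_pow_left₀ 2 (by positivity)
    rw [mul_pow, hsq]
    linarith
  have := actionPrim_sub_le (β := β) (a := -t) (b := t) (v := w) (u := fun z => √κ * z)
    (v' := v) (u' := fun _ => √κ) (by linarith) (by fun_prop) h.w_cont.continuousOn
    (fun z _ => by simpa using (hasDerivAt_id z).const_mul (√κ))
    (fun z hz => h.w_deriv z ⟨by linarith [hz.1], by linarith [hz.2]⟩ (by linarith [hz.2])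
      (by linarith [hz.1]))
    (fun z hz => (h.v_pos z ⟨by linarith [hz.1], by linarith [hz.2]⟩ (by linarith [hz.2])
      (by linarith [hz.1])).le) (by
      intro z hz
      have h1 := h.eqn z ⟨by linarith [hz.1], by linarith [hz.2]⟩ (by linarith [hz.2])
        (by linarith [hz.1])
      have h2 := h.F_bound_inner (z := z) ⟨by linarith [hz.1], by linarith [hz.2]⟩
      have h3 := h.w_sq_lt (z := z) ⟨by linarith [hz.1], by linarith [hz.2]⟩
      have hzt : z ^ 2 < t ^ 2 := by nlinarith [hz.1, hz.2]
      have hze : z ^ 2 < e ^ 2 := by nlinarith [hz.1, hz.2]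
      have hβt : β ^ 2 = κ * t ^ 2 := by rw [← htκ, mul_pow, hsq]
      rw [abs_of_neg (by linarith : w z ^ 2 - β ^ 2 < 0), mul_pow, hsq]
      rw [abs_of_neg (by nlinarith : κ * z ^ 2 - β ^ 2 < 0)]
      have h4 := (abs_le.1 h2).2
      have h5 : κ * (-(κ * z ^ 2 - β ^ 2)) ≤ κ * (κ * e ^ 2 - κ * z ^ 2) := by
        apply mul_le_mul_of_nonneg_left _ hκ0.le
        linarith
      have h6 : 0 ≤ (1 - κ) * (κ * (e ^ 2 - z ^ 2)) := by
        apply mul_nonneg (by linarith) (mul_nonneg hκ0.le (by linarith))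
      have h7 : κ * (e ^ 2 - z ^ 2) ≤ -F z := by rw [hκ]; linarith
      linarith)
  have h1 := h.w_mono (a := t) (b := e) ⟨by linarith, by linarith⟩ ⟨by linarith, by linarith⟩ hte
  have h2 := h.w_mono (a := -e) (b := -t) ⟨by linarith, by linarith⟩ ⟨by linarith, by linarith⟩
    (by linarith)
  rw [h.w_right] at h1
  rw [h.w_left] at h2
  have h3 := strictMono_actionPrim β (by linarith : w t < √κ * t)
  have h4 := strictMono_actionPrim β (by linarith : √κ * -t < w (-t))
  linarith

end NormalizedLanger

namespace NormalizedLanger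

variable {e β r K : ℝ} {w v F F1 F2 F3 : ℝ → ℝ}

lemma abs_eqn (h : NormalizedLanger e β r K w v F F1 F2 F3) {z : ℝ} (hz : z ∈ Ioo (-r) r)
    (h1 : z ≠ e) (h2 : z ≠ -e) : v z ^ 2 * |w z ^ 2 - β ^ 2| = |F z| := by
  rw [← h.eqn z hz h1 h2, abs_mul, abs_of_nonneg (sq_nonneg (v z))]

lemma hasDerivAt_trial {θ z : ℝ} (hpos : 0 < β ^ 2 + θ * (z ^ 2 - e ^ 2)) :
    HasDerivAt (fun z => √(β ^ 2 + θ * (z ^ 2 - e ^ 2)))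
      (θ * z / √(β ^ 2 + θ * (z ^ 2 - e ^ 2))) z := by
  have h1 : HasDerivAt (fun z : ℝ => β ^ 2 + θ * (z ^ 2 - e ^ 2)) (θ * (2 * z)) z :=
    (((hasDerivAt_pow 2 z).sub_const (e ^ 2)).const_mul θ).const_add (β ^ 2) |>.congr_deriv
      (by simp)
  refine (h1.sqrt hpos.ne').congr_deriv ?_
  have := (Real.sqrt_pos.2 hpos).ne'
  field_simp

lemma trial_sq {θ z : ℝ} (hpos : 0 < β ^ 2 + θ * (z ^ 2 - e ^ 2)) :
    (θ * z / √(β ^ 2 + θ * (z ^ 2 - e ^ 2))) ^ 2 *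
      |√(β ^ 2 + θ * (z ^ 2 - e ^ 2)) ^ 2 - β ^ 2| * (β ^ 2 + θ * (z ^ 2 - e ^ 2)) =
      (θ * z ^ 2) * (θ * |θ| * |z ^ 2 - e ^ 2|) := by
  rw [div_pow, Real.sq_sqrt hpos.le, add_sub_cancel_left, abs_mul]
  field_simp

lemma compare_upper (h : NormalizedLanger e β r K w v F F1 F2 F3) {a b θ : ℝ} (hab : a ≤ b)
    (ha : 0 ≤ a) (hb : b < r) (he : a = e ∨ b = e) (hθ : 0 < θ)
    (hpos : ∀ z ∈ Ioo a b, 0 < β ^ 2 + θ * (z ^ 2 - e ^ 2)) (hβ : β ^ 2 ≤ θ * e ^ 2)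
    (hF : ∀ z ∈ Ioo a b, |F z| ≤ θ ^ 2 * |z ^ 2 - e ^ 2|) :
    actionPrim β √(β ^ 2 + θ * (a ^ 2 - e ^ 2)) - actionPrim β (w a) ≤
      actionPrim β √(β ^ 2 + θ * (b ^ 2 - e ^ 2)) - actionPrim β (w b) := by
  have he0 := h.e_pos
  have her := h.e_lt
  have hne : ∀ z ∈ Ioo a b, z ∈ Ioo (-r) r ∧ z ≠ e ∧ z ≠ -e := fun z hz =>
    ⟨⟨by linarith [hz.1], by linarith [hz.2]⟩,
      by rcases he with he | he <;> [exact he ▸ hz.1.ne'; exact he ▸ hz.2.ne],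
      by linarith [hz.1]⟩
  refine actionPrim_sub_le (v' := fun z => θ * z / √(β ^ 2 + θ * (z ^ 2 - e ^ 2))) (u' := v)
    (v := fun z => √(β ^ 2 + θ * (z ^ 2 - e ^ 2))) hab
    h.w_cont.continuousOn (by fun_prop) (fun z hz => h.w_deriv z (hne z hz).1 (hne z hz).2.1
      (hne z hz).2.2) (fun z hz => hasDerivAt_trial (hpos z hz)) (fun z hz => ?_) fun z hz => ?_
  · have := hz.1
    have : 0 ≤ z := by linarith
    positivity
  · rw [h.abs_eqn (hne z hz).1 (hne z hz).2.1 (hne z hz).2.2]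
    refine (hF z hz).trans (le_of_mul_le_mul_right ?_ (hpos z hz))
    rw [trial_sq (hpos z hz), abs_of_pos hθ, mul_comm]
    have : β ^ 2 + θ * (z ^ 2 - e ^ 2) ≤ θ * z ^ 2 := by linarith
    rw [← pow_two]
    gcongr

lemma compare_lower (h : NormalizedLanger e β r K w v F F1 F2 F3) {a b θ : ℝ} (hab : a ≤ b)
    (ha : 0 ≤ a) (hb : b < r) (he : a = e ∨ b = e) (hθ : 0 < θ)
    (hβ : θ * e ^ 2 ≤ β ^ 2)
    (hF : ∀ z ∈ Ioo a b, θ ^ 2 * |z ^ 2 - e ^ 2| ≤ |F z|) :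
    actionPrim β (w a) - actionPrim β √(β ^ 2 + θ * (a ^ 2 - e ^ 2)) ≤
      actionPrim β (w b) - actionPrim β √(β ^ 2 + θ * (b ^ 2 - e ^ 2)) := by
  have he0 := h.e_pos
  have her := h.e_lt
  have hne : ∀ z ∈ Ioo a b, z ∈ Ioo (-r) r ∧ z ≠ e ∧ z ≠ -e := fun z hz =>
    ⟨⟨by linarith [hz.1], by linarith [hz.2]⟩,
      by rcases he with he | he <;> [exact he ▸ hz.1.ne'; exact he ▸ hz.2.ne],
      by linarith [hz.1]⟩
  have hle : ∀ z ∈ Ioo a b, θ * z ^ 2 ≤ β ^ 2 + θ * (z ^ 2 - e ^ 2) := fun z hz => by linarith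
  have hpos : ∀ z ∈ Ioo a b, 0 < β ^ 2 + θ * (z ^ 2 - e ^ 2) := fun z hz => by
    have : 0 < z := by linarith [hz.1]
    have : 0 < θ * z ^ 2 := by positivity
    linarith [hle z hz]
  refine actionPrim_sub_le (u' := fun z => θ * z / √(β ^ 2 + θ * (z ^ 2 - e ^ 2))) (v' := v)
    (u := fun z => √(β ^ 2 + θ * (z ^ 2 - e ^ 2))) hab
    (by fun_prop) h.w_cont.continuousOn (fun z hz => hasDerivAt_trial (hpos z hz))
    (fun z hz => h.w_deriv z (hne z hz).1 (hne z hz).2.1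
      (hne z hz).2.2) (fun z hz => (h.v_pos z (hne z hz).1 (hne z hz).2.1
      (hne z hz).2.2).le) fun z hz => ?_
  · rw [h.abs_eqn (hne z hz).1 (hne z hz).2.1 (hne z hz).2.2]
    refine (le_of_mul_le_mul_right ?_ (hpos z hz)).trans (hF z hz)
    rw [trial_sq (hpos z hz), abs_of_pos hθ, mul_comm (θ ^ 2 * _)]
    rw [← pow_two]
    exact mul_le_mul_of_nonneg_right (hle z hz) (by positivity)

lemma K_mul_sq_le (h : NormalizedLanger e β r K w v F F1 F2 F3) {t : ℝ} (ht0 : 0 ≤ t)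
    (ht : t ≤ 2 * r) : K * t ^ 2 ≤ 1 / 10 ^ 6 := by
  have := h.small
  have h1 : t ^ 2 ≤ (2 * r) ^ 2 := by gcongr
  nlinarith [h.K_nonneg, mul_le_mul_of_nonneg_left h1 h.K_nonneg]

lemma actionPrim_le_iff {β s t : ℝ} : actionPrim β s ≤ actionPrim β t ↔ s ≤ t :=
  (strictMono_actionPrim β).le_iff_le

lemma trial_at (h : NormalizedLanger e β r K w v F F1 F2 F3) (θ : ℝ) :
    √(β ^ 2 + θ * (e ^ 2 - e ^ 2)) = w e := by
  rw [sub_self, mul_zero, add_zero, Real.sqrt_sq h.beta_pos.le, h.w_right]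

lemma outer_bound (h : NormalizedLanger e β r K w v F F1 F2 F3) {z : ℝ} (hz : z ∈ Ico e r) :
    |w z ^ 2 - β ^ 2 - (z ^ 2 - e ^ 2)| ≤ K * (z + e) ^ 2 * (z ^ 2 - e ^ 2) := by
  have he := h.e_pos
  have hβ := h.beta_pos
  have hK := h.K_nonneg
  have hs := h.K_mul_sq_le (t := z + e) (by linarith [hz.1]) (by linarith [hz.1, hz.2])
  have hs0 : 0 ≤ K * (z + e) ^ 2 := by positivity
  have hX : 0 ≤ z ^ 2 - e ^ 2 := by nlinarith [hz.1]
  have h4 : 4 * K * e ^ 2 ≤ K * (z + e) ^ 2 := by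
    have : (2 * e) ^ 2 ≤ (z + e) ^ 2 := by
      have := hz.1
      gcongr
      linarith
    nlinarith [mul_le_mul_of_nonneg_left this hK]
  have hFb : ∀ y ∈ Ioo e z, |F y - (y ^ 2 - e ^ 2)| ≤ K * (z + e) ^ 2 * (y ^ 2 - e ^ 2) ∧
      0 ≤ y ^ 2 - e ^ 2 := by
    intro y hy
    have hY : 0 ≤ y ^ 2 - e ^ 2 := by nlinarith [hy.1]
    refine ⟨(h.F_bound_outer ⟨hy.1.le, by linarith [hy.2, hz.2]⟩).trans ?_, hY⟩
    have := hy.2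
    have : 0 ≤ y + e := by linarith [hy.1]
    gcongr
  have hw : β ≤ w z := by
    rcases eq_or_lt_of_le hz.1 with h1 | h1
    · rw [← h1, h.w_right]
    · exact (h.lt_w ⟨h1, hz.2⟩).le
  set η := K * (z + e) ^ 2 with hη
  have hηX : 0 ≤ η * (z ^ 2 - e ^ 2) := mul_nonneg hs0 hX
  have hup := h.compare_upper (θ := 1 + η) hz.1 he.le hz.2 (Or.inl rfl) (by linarith)
    (fun y hy => by
      have := mul_nonneg (by linarith : 0 ≤ 1 + η) (hFb y hy).2
      have : 0 < β ^ 2 := by positivity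
      linarith)
    (h.beta_sq_le.trans (by gcongr)) (fun y hy => by
      obtain ⟨h1, h2⟩ := hFb y hy
      have h3 := abs_sub_abs_le_abs_sub (F y) (y ^ 2 - e ^ 2)
      rw [abs_of_nonneg h2] at h3 ⊢
      nlinarith [mul_nonneg hs0 h2, mul_nonneg (mul_nonneg hs0 hs0) h2])
  have hlo := h.compare_lower (θ := 1 - η) hz.1 he.le hz.2 (Or.inl rfl) (by linarith)
    (le_trans (by gcongr) h.le_beta_sq) (fun y hy => by
      obtain ⟨h1, h2⟩ := hFb y hy
      have h3 := abs_sub_abs_le_abs_sub (y ^ 2 - e ^ 2) (F y)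
      rw [abs_sub_comm _ (F y), abs_of_nonneg h2] at h3
      rw [abs_of_nonneg h2]
      nlinarith [mul_nonneg hs0 h2, mul_nonneg (mul_nonneg hs0 (by linarith : 0 ≤ 1 - η)) h2])
  rw [h.trial_at, sub_self] at hup hlo
  rw [sub_nonneg, actionPrim_le_iff] at hup hlo
  have h5 := pow_le_pow_left₀ (by linarith) hup 2
  have h6 := pow_le_pow_left₀ (Real.sqrt_nonneg _) hlo 2
  rw [Real.sq_sqrt (by nlinarith)] at h5 h6
  rw [abs_le]
  constructor <;> linarith

lemma inner_lower (h : NormalizedLanger e β r K w v F F1 F2 F3) {z : ℝ} (hz : z ∈ Icc 0 e) :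
    w z ≤ √(β ^ 2 + (1 - 4 * K * e ^ 2) * (z ^ 2 - e ^ 2)) := by
  have he := h.e_pos
  have her := h.e_lt
  have hK := h.K_nonneg
  have hs := h.K_mul_sq_le (t := e) (by linarith) (by linarith)
  have hs0 : 0 ≤ 4 * K * e ^ 2 := by positivity
  have hlo := h.compare_lower (θ := 1 - 4 * K * e ^ 2) hz.2 hz.1 her (Or.inr rfl) (by linarith)
    h.le_beta_sq (fun y hy => by
      have h1 := h.F_bound_inner (z := y) ⟨by linarith [hy.1, hz.1], hy.2.le⟩
      have h2 : y ^ 2 - e ^ 2 ≤ 0 := by nlinarith [hy.1, hy.2, hz.1]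
      have h3 := abs_sub_abs_le_abs_sub (y ^ 2 - e ^ 2) (F y)
      rw [abs_sub_comm _ (F y), abs_of_nonpos h2] at h3
      rw [abs_of_nonpos h2]
      set η := 4 * K * e ^ 2
      nlinarith [mul_nonneg hs0 (neg_nonneg.2 h2),
        mul_nonneg (mul_nonneg hs0 (by linarith : 0 ≤ 1 - η)) (neg_nonneg.2 h2)])
  rw [h.trial_at, sub_self, sub_nonpos, actionPrim_le_iff] at hlo
  exact hlo

lemma near_bound (h : NormalizedLanger e β r K w v F F1 F2 F3) {z : ℝ} (hz : z ∈ Icc (e / 2) e) :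
    |w z ^ 2 - β ^ 2 - (z ^ 2 - e ^ 2)| ≤ 4 * K * e ^ 2 * (e ^ 2 - z ^ 2) ∧ 0 < w z := by
  have he := h.e_pos
  have her := h.e_lt
  have hK := h.K_nonneg
  have hs := h.K_mul_sq_le (t := e) (by linarith) (by linarith)
  have hs0 : 0 ≤ 4 * K * e ^ 2 := by positivity
  have hlow := h.inner_lower (z := z) ⟨by linarith [hz.1], hz.2⟩
  have hβ := h.le_beta_sq
  have hpos : ∀ y ∈ Icc (e / 2) e, 0 < β ^ 2 + (1 + 4 * K * e ^ 2) * (y ^ 2 - e ^ 2) ∧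
      y ^ 2 - e ^ 2 ≤ 0 := by
    intro y hy
    have h1 : e ^ 2 / 4 ≤ y ^ 2 := by nlinarith [hy.1]
    have h2 : y ^ 2 ≤ e ^ 2 := by nlinarith [hy.1, hy.2]
    have he2 : 0 < e ^ 2 := by positivity
    refine ⟨?_, by linarith⟩
    set η := 4 * K * e ^ 2
    nlinarith [mul_nonneg hs0 (by linarith : 0 ≤ e ^ 2 - y ^ 2)]
  have hup := h.compare_upper (θ := 1 + 4 * K * e ^ 2) hz.2 (by linarith [hz.1]) her (Or.inr rfl)
    (by linarith) (fun y hy => (hpos y ⟨by linarith [hy.1, hz.1], hy.2.le⟩).1) h.beta_sq_le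
    (fun y hy => by
      have h1 := h.F_bound_inner (z := y) ⟨by linarith [hy.1, hz.1], hy.2.le⟩
      have h2 := (hpos y ⟨by linarith [hy.1, hz.1], hy.2.le⟩).2
      have h3 := abs_sub_abs_le_abs_sub (F y) (y ^ 2 - e ^ 2)
      rw [abs_of_nonpos h2] at h3 ⊢
      set η := 4 * K * e ^ 2
      nlinarith [mul_nonneg hs0 (neg_nonneg.2 h2),
        mul_nonneg (mul_nonneg hs0 hs0) (neg_nonneg.2 h2)])
  rw [h.trial_at, sub_self, sub_nonpos, actionPrim_le_iff] at hup
  obtain ⟨hp, hX⟩ := hpos z hz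
  have hw : 0 < w z := (Real.sqrt_pos.2 hp).trans_le hup
  have h5 := pow_le_pow_left₀ (Real.sqrt_nonneg _) hup 2
  have h6 := pow_le_pow_left₀ hw.le hlow 2
  have hη : 0 ≤ 4 * K * e ^ 2 * (e ^ 2 - z ^ 2) := mul_nonneg hs0 (by linarith)
  rw [Real.sq_sqrt hp.le] at h5
  rw [Real.sq_sqrt (by linarith)] at h6
  refine ⟨?_, hw⟩
  rw [abs_le]
  constructor <;> linarith

/-- Control of `w² - β²` and of `w - z` to the right of `e / 2`. -/
lemma right_bounds (h : NormalizedLanger e β r K w v F F1 F2 F3) {z : ℝ} (hz : z ∈ Ico (e / 2) r) :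
    |w z ^ 2 - β ^ 2 - (z ^ 2 - e ^ 2)| ≤ 4 * K * (z + e) ^ 2 * |z ^ 2 - e ^ 2| ∧
      |w z - z| ≤ 24 * K * (z + e) ^ 3 := by
  have he := h.e_pos
  have her := h.e_lt
  have hK := h.K_nonneg
  have hz1 := hz.1
  have key : |w z ^ 2 - β ^ 2 - (z ^ 2 - e ^ 2)| ≤ 4 * K * (z + e) ^ 2 * |z ^ 2 - e ^ 2| ∧
      0 < w z := by
    rcases le_total z e with hze | hze
    · obtain ⟨h1, h2⟩ := h.near_bound ⟨hz.1, hze⟩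
      refine ⟨h1.trans ?_, h2⟩
      rw [abs_of_nonpos (by nlinarith), neg_sub]
      have : 0 ≤ e ^ 2 - z ^ 2 := by nlinarith
      gcongr
      linarith
    · have h1 := h.outer_bound ⟨hze, hz.2⟩
      have hw : β ≤ w z := by
        rcases eq_or_lt_of_le hze with h1 | h1
        · rw [← h1, h.w_right]
        · exact (h.lt_w ⟨h1, hz.2⟩).le
      refine ⟨h1.trans ?_, h.beta_pos.trans_le hw⟩
      have : 0 ≤ z ^ 2 - e ^ 2 := by nlinarith
      rw [abs_of_nonneg this]
      gcongr
      linarith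
  refine ⟨key.1, ?_⟩
  have hX : |z ^ 2 - e ^ 2| ≤ (z + e) ^ 2 := by
    rw [abs_le]; constructor <;> nlinarith
  have h2 : |w z ^ 2 - β ^ 2 - (z ^ 2 - e ^ 2)| ≤ 4 * K * (z + e) ^ 2 * (z + e) ^ 2 :=
    key.1.trans (by gcongr)
  have h3 : |β ^ 2 - e ^ 2| ≤ 4 * K * (z + e) ^ 2 * (z + e) ^ 2 := by
    have : 4 * K * e ^ 2 * e ^ 2 ≤ 4 * K * (z + e) ^ 2 * (z + e) ^ 2 := by
      gcongr <;> linarith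
    rw [abs_le]
    constructor <;> linarith [h.beta_sq_le, h.le_beta_sq]
  have h4 : |w z ^ 2 - z ^ 2| ≤ 8 * K * (z + e) ^ 4 := by
    rw [abs_le] at *
    constructor <;> linarith
  have h5 : |w z - z| * (w z + z) = |w z ^ 2 - z ^ 2| := by
    rw [← abs_of_pos (by linarith [key.2] : 0 < w z + z), ← abs_mul]
    ring_nf
  have h6 : |w z - z| * ((z + e) / 3) ≤ |w z - z| * (w z + z) := by
    gcongr
    linarith [key.2]
  have h7 : 0 < z + e := by linarith
  apply le_of_mul_le_mul_right _ (by linarith : 0 < (z + e) / 3)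
  linarith

end NormalizedLanger

namespace NormalizedLanger

variable {e β r K : ℝ} {w v F F1 F2 F3 : ℝ → ℝ}

/-- On the middle part of the well the solution stays away from the turning values. -/
lemma abs_w_middle (h : NormalizedLanger e β r K w v F F1 F2 F3) {z : ℝ}
    (hz : z ∈ Icc (-(3 / 5 * e)) (e / 2)) : |w z| ≤ 7 / 10 * e := by
  have he := h.e_pos
  have her := h.e_lt
  have hK := h.K_nonneg
  have hs := h.K_mul_sq_le (t := e) (by linarith) (by linarith)
  have hs0 : 0 ≤ K * e ^ 2 := by positivity
  have he2 : 0 < e ^ 2 := by positivity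
  have hβ := h.beta_sq_le
  have hs2 : 4 * (K * e ^ 2) * e ^ 2 ≤ 4 / 10 ^ 6 * e ^ 2 := by gcongr; linarith
  have hb : ∀ y : ℝ, y ^ 2 ≤ (3 / 5 * e) ^ 2 →
      √(β ^ 2 + (1 - 4 * K * e ^ 2) * (y ^ 2 - e ^ 2)) ≤ 7 / 10 * e := by
    intro y hy
    apply Real.sqrt_le_iff.2 ⟨by positivity, ?_⟩
    have h2 : 0 ≤ 4 * (K * e ^ 2) * y ^ 2 := by positivity
    nlinarith
  have h1 := h.inner_lower (z := e / 2) ⟨by linarith, by linarith⟩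
  have h2 := h.reflect.inner_lower (z := 3 / 5 * e) ⟨by linarith, by linarith⟩
  have h3 := hb (e / 2) (by nlinarith)
  have h4 := hb (3 / 5 * e) le_rfl
  have hmem : ∀ y ∈ Icc (-(3 / 5 * e)) (e / 2), y ∈ Ioo (-r) r := fun y hy =>
    ⟨by linarith [hy.1], by linarith [hy.2]⟩
  have h5 := h.w_mono.monotoneOn (hmem z hz) (hmem _ ⟨by linarith, le_rfl⟩) hz.2
  have h6 := h.w_mono.monotoneOn (hmem _ ⟨le_rfl, by linarith⟩) (hmem z hz) hz.1
  rw [abs_le]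
  constructor <;> linarith

lemma abs_beta_sq_sub (h : NormalizedLanger e β r K w v F F1 F2 F3) :
    |β ^ 2 - e ^ 2| ≤ 4 * K * e ^ 4 := by
  rw [abs_le]
  constructor <;> linarith [h.beta_sq_le, h.le_beta_sq]

lemma middle_bound (h : NormalizedLanger e β r K w v F F1 F2 F3) {z : ℝ}
    (hz : z ∈ Icc (-(3 / 5 * e)) (e / 2)) : |w z - z| ≤ 200 * K * e ^ 3 := by
  have he := h.e_pos
  have her := h.e_lt
  have hK := h.K_nonneg
  have hs := h.K_mul_sq_le (t := e) (by linarith) (by linarith)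
  have hs0 : 0 ≤ K * e ^ 2 := by positivity
  have he2 : 0 < e ^ 2 := by positivity
  have hs2 : K * e ^ 2 * e ^ 2 ≤ 1 / 10 ^ 6 * e ^ 2 := by gcongr
  have hβe := abs_le.1 h.abs_beta_sq_sub
  have hsq : ∀ y : ℝ, |y| ≤ 7 / 10 * e → y ^ 2 ≤ 49 / 100 * e ^ 2 := fun y hy => by
    rw [← sq_abs]
    nlinarith [abs_nonneg y]
  have hD : ∀ t : ℝ, |t| ≤ 7 / 10 * e → 3 / 5 * e ≤ √|t ^ 2 - β ^ 2| ∧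
      √|t ^ 2 - β ^ 2| ≤ 11 / 10 * e := by
    intro t ht
    have h1 := hsq t ht
    have h2 := sq_nonneg t
    rw [abs_of_neg (by nlinarith)]
    constructor
    · apply Real.le_sqrt_of_sq_le
      nlinarith
    · apply Real.sqrt_le_iff.2 ⟨by positivity, ?_⟩
      nlinarith
  have hmem : ∀ y ∈ Icc z (e / 2), y ∈ Icc (-(3 / 5 * e)) (e / 2) := fun y hy =>
    ⟨by linarith [hy.1, hz.1], hy.2⟩
  have habs : ∀ y ∈ Icc (-(3 / 5 * e)) (e / 2), |y| ≤ 3 / 5 * e := fun y hy =>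
    abs_le.2 ⟨hy.1, by linarith [hy.2]⟩
  -- the two actions differ by `O(e⁴)`
  have hder : ∀ y ∈ Icc z (e / 2), HasDerivWithinAt
      (fun y => actionPrim β (w y) - actionPrim β y)
      (√|w y ^ 2 - β ^ 2| * v y - √|y ^ 2 - β ^ 2|) (Icc z (e / 2)) y := fun y hy => by
    have hy' := hmem y hy
    exact (((hasDerivAt_actionPrim β (w y)).comp y
      (h.w_deriv y ⟨by linarith [hy'.1], by linarith [hy'.2]⟩ (by linarith [hy'.2])
        (by linarith [hy'.1]))).sub (hasDerivAt_actionPrim β y)).hasDerivWithinAt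
  have hbd : ∀ y ∈ Icc z (e / 2),
      ‖√|w y ^ 2 - β ^ 2| * v y - √|y ^ 2 - β ^ 2|‖ ≤ 14 * K * e ^ 3 := fun y hy => by
    have hy' := hmem y hy
    have hy2 : y ∈ Ioo (-r) r := ⟨by linarith [hy'.1], by linarith [hy'.2]⟩
    have hv := h.v_pos y hy2 (by linarith [hy'.2]) (by linarith [hy'.1])
    have h1 := h.abs_eqn hy2 (by linarith [hy'.2]) (by linarith [hy'.1])
    have h2 := h.F_bound_inner (z := y) ⟨by linarith [hy'.1], by linarith [hy'.2]⟩
    have h3 : y ^ 2 ≤ 49 / 100 * e ^ 2 := hsq y (by linarith [habs y hy'])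
    set A := √|w y ^ 2 - β ^ 2| * v y with hA
    set B := √|y ^ 2 - β ^ 2| with hB
    have hA0 : 0 ≤ A := by positivity
    have hBl : 3 / 5 * e ≤ B := (hD y (by linarith [habs y hy'])).1
    have hA2 : A ^ 2 = |F y| := by
      rw [hA, mul_pow, Real.sq_sqrt (abs_nonneg _), ← h1, mul_comm]
    have hB2 : B ^ 2 = β ^ 2 - y ^ 2 := by
      rw [hB, Real.sq_sqrt (abs_nonneg _), abs_of_neg (by nlinarith), neg_sub]
    have h2' : |F y - (y ^ 2 - e ^ 2)| ≤ 4 * K * e ^ 4 := by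
      refine h2.trans ?_
      have : 4 * K * e ^ 2 * (e ^ 2 - y ^ 2) ≤ 4 * K * e ^ 2 * e ^ 2 := by
        gcongr
        linarith [sq_nonneg y]
      linarith
    rw [abs_le] at h2'
    rw [abs_of_neg (by nlinarith)] at hA2
    have h4 : |A ^ 2 - B ^ 2| ≤ 8 * K * e ^ 4 := by
      rw [hA2, hB2, abs_le]
      constructor <;> linarith
    have h5 : |A - B| * (A + B) = |A ^ 2 - B ^ 2| := by
      rw [← abs_of_nonneg (by linarith : 0 ≤ A + B), ← abs_mul]
      ring_nf
    have h6 : |A - B| * (3 / 5 * e) ≤ |A - B| * (A + B) := by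
      gcongr
      linarith
    rw [Real.norm_eq_abs]
    apply le_of_mul_le_mul_right _ (by linarith : 0 < 3 / 5 * e)
    have : 0 ≤ K * e ^ 4 := by positivity
    linarith
  have hmv := (convex_Icc z (e / 2)).norm_image_sub_le_of_norm_hasDerivWithin_le hder hbd
    (⟨le_rfl, hz.2⟩ : z ∈ Icc z (e / 2)) (⟨hz.2, le_rfl⟩ : e / 2 ∈ Icc z (e / 2))
  have hlen : ‖e / 2 - z‖ ≤ 11 / 10 * e := by
    rw [Real.norm_eq_abs, abs_of_nonneg (by linarith [hz.2])]
    linarith [hz.1]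
  have hmv2 := hmv.trans (mul_le_mul_of_nonneg_left hlen (by positivity : 0 ≤ 14 * K * e ^ 3))
  -- value at `e / 2`
  have hcmp : ∀ y ∈ Icc (-(3 / 5 * e)) (e / 2), ∃ c : ℝ, 3 / 5 * e ≤ c ∧ c ≤ 11 / 10 * e ∧
      actionPrim β (w y) - actionPrim β y = c * (w y - y) := by
    intro y hy
    rcases eq_or_ne (w y) y with heq | hne
    · exact ⟨e, by linarith, by linarith, by rw [heq]; ring⟩
    have hc : Continuous (actionPrim β) :=
      continuous_iff_continuousAt.2 fun t => (hasDerivAt_actionPrim β t).continuousAt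
    have hw := abs_le.1 (h.abs_w_middle hy)
    have hy3 := abs_le.1 (habs y hy)
    rcases lt_or_gt_of_ne hne with hlt | hlt
    · obtain ⟨c, hc1, hc2⟩ := exists_hasDerivAt_eq_slope (actionPrim β) _ hlt hc.continuousOn
        (fun t _ => hasDerivAt_actionPrim β t)
      have := hD c (abs_le.2 ⟨by linarith [hc1.1], by linarith [hc1.2]⟩)
      refine ⟨_, this.1, this.2, ?_⟩
      rw [hc2]
      have : y - w y ≠ 0 := by linarith
      field_simp
      ring
    · obtain ⟨c, hc1, hc2⟩ := exists_hasDerivAt_eq_slope (actionPrim β) _ hlt hc.continuousOn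
        (fun t _ => hasDerivAt_actionPrim β t)
      have := hD c (abs_le.2 ⟨by linarith [hc1.1], by linarith [hc1.2]⟩)
      refine ⟨_, this.1, this.2, ?_⟩
      rw [hc2]
      have : w y - y ≠ 0 := by linarith
      field_simp
  obtain ⟨c, hc1, hc2, hc3⟩ := hcmp z hz
  obtain ⟨d, hd1, hd2, hd3⟩ := hcmp (e / 2) ⟨by linarith, le_rfl⟩
  have hr2 := (h.right_bounds (z := e / 2) ⟨le_rfl, by linarith⟩).2
  rw [hc3, hd3, Real.norm_eq_abs] at hmv2
  have h7 : |d * (w (e / 2) - e / 2)| ≤ 90 * K * e ^ 4 := by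
    rw [abs_mul, abs_of_nonneg (by linarith : 0 ≤ d)]
    calc d * |w (e / 2) - e / 2| ≤ (11 / 10 * e) * (24 * K * (e / 2 + e) ^ 3) := by gcongr
      _ ≤ 90 * K * e ^ 4 := by
        have : 0 ≤ K * e ^ 4 := by positivity
        linarith
  have h8 : |c * (w z - z)| ≤ 106 * K * e ^ 4 := by
    have : 0 ≤ K * e ^ 4 := by positivity
    rw [abs_le] at *
    constructor <;> linarith
  rw [abs_mul, abs_of_nonneg (by linarith : 0 ≤ c)] at h8
  apply le_of_mul_le_mul_left _ (by linarith : 0 < 3 / 5 * e)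
  have h9 : 3 / 5 * e * |w z - z| ≤ c * |w z - z| := by gcongr
  have : 0 ≤ K * e ^ 4 := by positivity
  linarith

/-- The zeroth-order estimates, on the whole inner region. -/
lemma bounds (h : NormalizedLanger e β r K w v F F1 F2 F3) {z : ℝ}
    (hz : z ∈ Ioo (-(3 / 5 * e)) r) :
    |w z ^ 2 - β ^ 2 - (z ^ 2 - e ^ 2)| ≤ 500 * K * (|z| + e) ^ 2 * |z ^ 2 - e ^ 2| ∧
      |w z - z| ≤ 200 * K * (|z| + e) ^ 3 ∧
      |F z - (z ^ 2 - e ^ 2)| ≤ 4 * K * (|z| + e) ^ 2 * |z ^ 2 - e ^ 2| := by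
  have he := h.e_pos
  have her := h.e_lt
  have hK := h.K_nonneg
  have hF : |F z - (z ^ 2 - e ^ 2)| ≤ 4 * K * (|z| + e) ^ 2 * |z ^ 2 - e ^ 2| := by
    rcases le_total z e with hze | hze
    · have hX : 0 ≤ e ^ 2 - z ^ 2 := by nlinarith [hz.1]
      refine (h.F_bound_inner ⟨by linarith [hz.1], hze⟩).trans ?_
      rw [abs_sub_comm (z ^ 2), abs_of_nonneg hX]
      gcongr
      linarith [abs_nonneg z]
    · have hX : 0 ≤ z ^ 2 - e ^ 2 := by nlinarith [hz.1]
      refine (h.F_bound_outer ⟨hze, hz.2⟩).trans ?_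
      rw [abs_of_nonneg hX, abs_of_nonneg (he.le.trans hze)]
      gcongr
      linarith
  rcases le_total (e / 2) z with hze | hze
  · have h1 := h.right_bounds ⟨hze, hz.2⟩
    have hz0 : 0 ≤ z + e := by linarith
    rw [abs_of_nonneg (by linarith : 0 ≤ z)] at hF ⊢
    refine ⟨h1.1.trans ?_, h1.2.trans ?_, hF⟩
    · gcongr; norm_num
    · gcongr; norm_num
  · have hzI : z ∈ Icc (-(3 / 5 * e)) (e / 2) := ⟨hz.1.le, hze⟩
    have h1 := h.middle_bound hzI
    have h2 := abs_le.1 (h.abs_w_middle hzI)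
    have h3 := abs_le.1 h.abs_beta_sq_sub
    have hz2 : z ^ 2 ≤ 36 / 100 * e ^ 2 := by nlinarith [hz.1]
    refine ⟨?_, h1.trans ?_, hF⟩
    · have h4 : |w z ^ 2 - z ^ 2| ≤ 260 * K * e ^ 4 := by
        rw [show w z ^ 2 - z ^ 2 = (w z - z) * (w z + z) by ring, abs_mul]
        calc |w z - z| * |w z + z| ≤ (200 * K * e ^ 3) * (13 / 10 * e) := by
              gcongr
              rw [abs_le]
              constructor <;> linarith [hz.1]
          _ = _ := by ring
      rw [abs_sub_comm (z ^ 2), abs_of_nonneg (by nlinarith : 0 ≤ e ^ 2 - z ^ 2)]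
      have h5 : 500 * K * e ^ 2 * (64 / 100 * e ^ 2) ≤
          500 * K * (|z| + e) ^ 2 * (e ^ 2 - z ^ 2) := by
        gcongr
        · linarith [abs_nonneg z]
        · linarith
      have : 0 ≤ K * e ^ 4 := by positivity
      rw [abs_le] at h4
      rw [abs_le]
      constructor <;> linarith
    · gcongr
      linarith [abs_nonneg z]

end NormalizedLanger

/-- A solution of `T f' + α T' f = R` which does not blow up faster than `1 / T` at the zero `a` of
the increasing function `T` is controlled by `R`. -/
lemma abs_le_of_singular_ode_right {a Z α Rm B : ℝ} {T T1 f f1 : ℝ → ℝ} (haZ : a < Z) (hα : 1 < α)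
    (hTc : ContinuousOn T (Icc a Z)) (hTa : T a = 0)
    (hT : ∀ t ∈ Ioc a Z, HasDerivAt T (T1 t) t) (hT1 : ∀ t ∈ Ioc a Z, 0 ≤ T1 t)
    (hTpos : ∀ t ∈ Ioc a Z, 0 < T t) (hf : ∀ t ∈ Ioc a Z, HasDerivAt f (f1 t) t)
    (hR : ∀ t ∈ Ioc a Z, |T t * f1 t + α * T1 t * f t| ≤ Rm)
    (hB : ∀ t ∈ Ioc a Z, |T t * f t| ≤ B) :
    |f Z| ≤ Rm * ((Z - a) / T Z) := by
  have hd : ∀ t ∈ Ioc a Z, HasDerivAt (fun t => T t ^ α * f t)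
      (T t ^ (α - 1) * (T t * f1 t + α * T1 t * f t)) t := by
    intro t ht
    refine (((hT t ht).rpow_const (p := α) (Or.inl (hTpos t ht).ne')).mul (hf t ht)).congr_deriv ?_
    have : T t ^ α = T t ^ (α - 1) * T t := by
      rw [← Real.rpow_add_one (hTpos t ht).ne', sub_add_cancel]
    rw [this]
    ring
  have hmono : MonotoneOn T (Icc a Z) := by
    apply monotoneOn_of_deriv_nonneg (convex_Icc a Z) hTc
    · rw [interior_Icc]
      exact fun t ht => (hT t (Ioo_subset_Ioc_self ht)).differentiableAt.differentiableWithinAt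
    · rw [interior_Icc]
      intro t ht
      rw [(hT t (Ioo_subset_Ioc_self ht)).deriv]
      exact hT1 t (Ioo_subset_Ioc_self ht)
  have hc : ContinuousOn (fun t => T t ^ α * f t) (Icc a Z) := by
    intro t ht
    rcases eq_or_lt_of_le ht.1 with rfl | hlt
    · have hlim : Filter.Tendsto (fun t => T t ^ (α - 1) * B) (nhdsWithin a (Icc a Z))
          (nhds 0) := by
        have h1 := ((hTc a ht).rpow_const (p := α - 1) (Or.inr (by linarith))).mul_const B
        rwa [ContinuousWithinAt, hTa, Real.zero_rpow (by linarith), zero_mul] at h1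
      rw [ContinuousWithinAt, hTa, Real.zero_rpow (by linarith), zero_mul]
      apply squeeze_zero_norm' _ hlim
      filter_upwards [self_mem_nhdsWithin] with t ht'
      rcases eq_or_lt_of_le ht'.1 with rfl | hlt'
      · simp [hTa, Real.zero_rpow (by linarith : α ≠ 0), Real.zero_rpow (by linarith : α - 1 ≠ 0)]
      · have h0 := hTpos t ⟨hlt', ht'.2⟩
        have : T t ^ α * f t = T t ^ (α - 1) * (T t * f t) := by
          rw [← mul_assoc, ← Real.rpow_add_one h0.ne', sub_add_cancel]
        rw [this, Real.norm_eq_abs, abs_mul, abs_of_nonneg (Real.rpow_nonneg h0.le _)]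
        exact mul_le_mul_of_nonneg_left (hB t ⟨hlt', ht'.2⟩) (Real.rpow_nonneg h0.le _)
    · exact (hd t ⟨hlt, ht.2⟩).continuousAt.continuousWithinAt
  obtain ⟨t, ht, hslope⟩ := exists_hasDerivAt_eq_slope _ _ haZ hc
    (fun t ht => hd t (Ioo_subset_Ioc_self ht))
  have ht' := Ioo_subset_Ioc_self ht
  have hZ := hTpos Z ⟨haZ, le_rfl⟩
  simp only [hTa, Real.zero_rpow (by linarith : α ≠ 0), zero_mul, sub_zero] at hslope
  rw [eq_div_iff (by linarith)] at hslope
  have hle : T t ^ (α - 1) ≤ T Z ^ (α - 1) :=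
    Real.rpow_le_rpow (hTpos t ht').le (hmono ⟨ht.1.le, ht.2.le⟩ ⟨haZ.le, le_rfl⟩ ht.2.le)
      (by linarith)
  have hpow : T Z ^ α = T Z ^ (α - 1) * T Z := by
    rw [← Real.rpow_add_one hZ.ne', sub_add_cancel]
  have hq : 0 < T Z ^ (α - 1) := Real.rpow_pos_of_pos hZ _
  have h1 : |T Z ^ α * f Z| ≤ T Z ^ (α - 1) * Rm * (Z - a) := by
    rw [← hslope, abs_mul, abs_mul, abs_of_nonneg (Real.rpow_nonneg (hTpos t ht').le _),
      abs_of_pos (sub_pos.2 haZ)]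
    gcongr
    exact hR t ht'
  rw [hpow, abs_mul, abs_mul, abs_of_pos hq, abs_of_pos hZ] at h1
  rw [← mul_div_assoc, le_div_iff₀ hZ]
  apply le_of_mul_le_mul_left _ hq
  linarith

lemma abs_le_of_singular_ode_left {a Z α Rm B : ℝ} {T T1 f f1 : ℝ → ℝ} (haZ : Z < a) (hα : 1 < α)
    (hTc : ContinuousOn T (Icc Z a)) (hTa : T a = 0)
    (hT : ∀ t ∈ Ico Z a, HasDerivAt T (T1 t) t) (hT1 : ∀ t ∈ Ico Z a, 0 ≤ T1 t)
    (hTneg : ∀ t ∈ Ico Z a, T t < 0) (hf : ∀ t ∈ Ico Z a, HasDerivAt f (f1 t) t)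
    (hR : ∀ t ∈ Ico Z a, |T t * f1 t + α * T1 t * f t| ≤ Rm)
    (hB : ∀ t ∈ Ico Z a, |T t * f t| ≤ B) :
    |f Z| ≤ Rm * ((Z - a) / T Z) := by
  have hm : ∀ t ∈ Ioc (-a) (-Z), -t ∈ Ico Z a := fun t ht =>
    ⟨by linarith [ht.2], by linarith [ht.1]⟩
  have := abs_le_of_singular_ode_right (a := -a) (Z := -Z) (α := α) (Rm := Rm) (B := B)
    (T := fun t => -T (-t)) (T1 := fun t => T1 (-t)) (f := fun t => f (-t))
    (f1 := fun t => -f1 (-t)) (by linarith) hα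
    ((hTc.comp continuousOn_neg (fun t ht => ⟨by linarith [ht.2], by linarith [ht.1]⟩)).neg)
    (by simp [hTa])
    (fun t ht => ((hT _ (hm t ht)).comp t (hasDerivAt_neg t)).neg.congr_deriv (by simp))
    (fun t ht => hT1 _ (hm t ht)) (fun t ht => neg_pos.2 (hTneg _ (hm t ht)))
    (fun t ht => ((hf _ (hm t ht)).comp t (hasDerivAt_neg t)).congr_deriv (by simp))
    (fun t ht => by simpa using hR _ (hm t ht))
    (fun t ht => by simpa [abs_mul] using hB _ (hm t ht))
  simp only [neg_neg] at this
  convert this using 2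
  rw [← neg_div_neg_eq]
  congr 1
  ring

/-- Two-sided version of the previous two lemmas. -/
lemma abs_le_of_singular_ode {a Z α Rm B : ℝ} {T T1 f f1 : ℝ → ℝ} (haZ : Z ≠ a) (hα : 1 < α)
    (hTc : ContinuousOn T (uIcc a Z)) (hTa : T a = 0)
    (hT : ∀ t ∈ uIcc a Z, t ≠ a → HasDerivAt T (T1 t) t)
    (hT1 : ∀ t ∈ uIcc a Z, t ≠ a → 0 ≤ T1 t)
    (hTpos : ∀ t ∈ uIcc a Z, t ≠ a → 0 < (t - a) * T t)
    (hf : ∀ t ∈ uIcc a Z, t ≠ a → HasDerivAt f (f1 t) t)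
    (hR : ∀ t ∈ uIcc a Z, t ≠ a → |T t * f1 t + α * T1 t * f t| ≤ Rm)
    (hB : ∀ t ∈ uIcc a Z, t ≠ a → |T t * f t| ≤ B) :
    |f Z| ≤ Rm * ((Z - a) / T Z) := by
  rcases lt_or_gt_of_ne haZ with hlt | hlt
  · rw [uIcc_of_ge hlt.le] at *
    have hm : ∀ t ∈ Ico Z a, t ∈ Icc Z a := fun t ht => ⟨ht.1, ht.2.le⟩
    exact abs_le_of_singular_ode_left hlt hα hTc hTa (fun t ht => hT t (hm t ht) ht.2.ne)
      (fun t ht => hT1 t (hm t ht) ht.2.ne)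
      (fun t ht => neg_of_mul_pos_right (hTpos t (hm t ht) ht.2.ne) (by linarith [ht.2]))
      (fun t ht => hf t (hm t ht) ht.2.ne)
      (fun t ht => hR t (hm t ht) ht.2.ne) (fun t ht => hB t (hm t ht) ht.2.ne)
  · rw [uIcc_of_le hlt.le] at *
    have hm : ∀ t ∈ Ioc a Z, t ∈ Icc a Z := fun t ht => ⟨ht.1.le, ht.2⟩
    exact abs_le_of_singular_ode_right hlt hα hTc hTa (fun t ht => hT t (hm t ht) ht.1.ne')
      (fun t ht => hT1 t (hm t ht) ht.1.ne')
      (fun t ht => pos_of_mul_pos_right (hTpos t (hm t ht) ht.1.ne') (by linarith [ht.1]))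
      (fun t ht => hf t (hm t ht) ht.1.ne')
      (fun t ht => hR t (hm t ht) ht.1.ne') (fun t ht => hB t (hm t ht) ht.1.ne')

namespace NormalizedLanger

variable {e β r K : ℝ} {w v F F1 F2 F3 : ℝ → ℝ}

lemma pointwise (h : NormalizedLanger e β r K w v F F1 F2 F3) {z : ℝ}
    (hz : z ∈ Ioo (-(3 / 5 * e)) r) (hze : z ≠ e) :
    K * (|z| + e) ^ 2 ≤ 1 / 10 ^ 6 ∧ 999 / 1000 * ((z + e) * |z - e|) ≤ |w z ^ 2 - β ^ 2| ∧
      0 < (z - e) * (w z ^ 2 - β ^ 2) ∧ |v z - 1| ≤ 510 * (K * (|z| + e) ^ 2) ∧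
      |w z - z| ≤ 200 * (K * (|z| + e) ^ 2) * (|z| + e) ∧ 0 < v z ∧
      HasDerivAt w (v z) z ∧ v z ^ 2 * (w z ^ 2 - β ^ 2) = F z := by
  have he := h.e_pos
  have her := h.e_lt
  have hK := h.K_nonneg
  have hzr : z ∈ Ioo (-r) r := ⟨by linarith [hz.1], hz.2⟩
  have hzl : z ≠ -e := by linarith [hz.1]
  obtain ⟨hT, hw, hF⟩ := h.bounds hz
  have habs : |z| ≤ r := abs_le.2 ⟨by linarith [hz.1], hz.2.le⟩
  have hM : 0 < |z| + e := by positivity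
  have hκ := h.K_mul_sq_le (t := |z| + e) hM.le (by linarith)
  have hκ0 : 0 ≤ K * (|z| + e) ^ 2 := by positivity
  have hv := h.v_pos z hzr hze hzl
  have heq := h.eqn z hzr hze hzl
  set κ := K * (|z| + e) ^ 2 with hκd
  set X := z ^ 2 - e ^ 2 with hX
  set T := w z ^ 2 - β ^ 2 with hTd
  have hze0 : 0 < z + e := by linarith [hz.1]
  have hXabs : |X| = (z + e) * |z - e| := by
    rw [hX, show z ^ 2 - e ^ 2 = (z + e) * (z - e) by ring, abs_mul, abs_of_pos hze0]
  have hX0 : 0 < |X| := by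
    rw [hXabs]
    have := abs_pos.2 (sub_ne_zero.2 hze)
    positivity
  have hTX : |T - X| ≤ 500 * κ * |X| := by
    rw [hκd]; convert hT using 1; ring
  have hFX : |F z - X| ≤ 4 * κ * |X| := by
    rw [hκd]; convert hF using 1; ring
  have hTX' : |T - X| ≤ 1 / 1000 * |X| := hTX.trans (by gcongr; linarith)
  have hTabs : 999 / 1000 * |X| ≤ |T| := by
    have := abs_sub_abs_le_abs_sub X T
    rw [abs_sub_comm X T] at this
    linarith
  refine ⟨hκ, hXabs ▸ hTabs, ?_, ?_, ?_, hv, h.w_deriv z hzr hze hzl, heq⟩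
  · have h1 := abs_le.1 hTX'
    rcases lt_or_gt_of_ne hze with hlt | hlt
    · have : X < 0 := by rw [hX]; nlinarith
      rw [abs_of_neg this] at h1
      nlinarith
    · have : 0 < X := by rw [hX]; nlinarith
      rw [abs_of_pos this] at h1
      nlinarith
  · have h1 : |F z - T| ≤ 504 * κ * |X| := by
      have := abs_sub_le (F z) X T
      rw [abs_sub_comm X] at this
      linarith
    have h2 : |v z ^ 2 - 1| * |T| ≤ 504 * κ * |X| := by
      rwa [← abs_mul, sub_one_mul, heq]
    have h3 : |v z - 1| ≤ |v z ^ 2 - 1| := by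
      rw [show v z ^ 2 - 1 = (v z - 1) * (v z + 1) by ring, abs_mul,
        abs_of_pos (by linarith : 0 < v z + 1)]
      exact le_mul_of_one_le_right (abs_nonneg _) (by linarith)
    refine h3.trans (le_of_mul_le_mul_right (h2.trans ?_) (by linarith : 0 < |T|))
    have : 504 * κ * |X| ≤ 504 * κ * (1000 / 999 * |T|) := by gcongr; linarith
    have : 0 ≤ κ * |T| := by positivity
    linarith
  · rw [hκd]; convert hw using 1; ring

lemma hasDerivAt_v (h : NormalizedLanger e β r K w v F F1 F2 F3) {z : ℝ}
    (hz : z ∈ Ioo (-(3 / 5 * e)) r) (hze : z ≠ e) :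
    HasDerivAt v ((F1 z - 2 * w z * v z ^ 3) / (w z ^ 2 - β ^ 2) / (2 * v z)) z := by
  have he := h.e_pos
  have her := h.e_lt
  obtain ⟨-, -, hT, -, -, hv, hw, heq⟩ := h.pointwise hz hze
  have hT0 : w z ^ 2 - β ^ 2 ≠ 0 := right_ne_zero_of_mul hT.ne'
  have hnear : ∀ᶠ y in nhds z, v y = √(F y / (w y ^ 2 - β ^ 2)) := by
    filter_upwards [isOpen_Ioo.mem_nhds hz, isOpen_ne.mem_nhds hze] with y hy hye
    obtain ⟨-, -, hT, -, -, hv, hw, heq⟩ := h.pointwise hy hye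
    have hT0 : w y ^ 2 - β ^ 2 ≠ 0 := right_ne_zero_of_mul hT.ne'
    rw [← heq, mul_div_assoc, div_self hT0, mul_one, Real.sqrt_sq hv.le]
  have hq : F z / (w z ^ 2 - β ^ 2) = v z ^ 2 := by
    rw [← heq, mul_div_assoc, div_self hT0, mul_one]
  have hd := (((h.F_deriv z ⟨by linarith [hz.1], hz.2⟩).div
    ((hw.pow 2).sub_const (β ^ 2)) hT0).sqrt (by simp [hq, hv.ne'])).congr_of_eventuallyEq hnear
  refine hd.congr_deriv ?_
  simp only [Pi.div_apply, Pi.pow_apply, hq, Real.sqrt_sq hv.le]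
  rw [← heq]
  field_simp
  ring

/-- The derivative of `v²`. -/
noncomputable def dv2 (β : ℝ) (w v F1 : ℝ → ℝ) (z : ℝ) : ℝ :=
  (F1 z - 2 * w z * v z ^ 3) / (w z ^ 2 - β ^ 2)

/-- The second derivative of `v²`. -/
noncomputable def ddv2 (β : ℝ) (w v F1 F2 : ℝ → ℝ) (z : ℝ) : ℝ :=
  (F2 z - 2 * v z ^ 4 - 5 * w z * v z * dv2 β w v F1 z) / (w z ^ 2 - β ^ 2)

lemma hasDerivAt_dv2 (h : NormalizedLanger e β r K w v F F1 F2 F3) {z : ℝ}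
    (hz : z ∈ Ioo (-(3 / 5 * e)) r) (hze : z ≠ e) :
    HasDerivAt (dv2 β w v F1) (ddv2 β w v F1 F2 z) z := by
  have he := h.e_pos
  have her := h.e_lt
  obtain ⟨-, -, hT, -, -, hv, hw, heq⟩ := h.pointwise hz hze
  have hT0 : w z ^ 2 - β ^ 2 ≠ 0 := right_ne_zero_of_mul hT.ne'
  have hd := ((h.F1_deriv z ⟨by linarith [hz.1], hz.2⟩).sub
    ((hw.const_mul 2).mul ((h.hasDerivAt_v hz hze).pow 3))).div
    ((hw.pow 2).sub_const (β ^ 2)) hT0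
  refine hd.congr_deriv ?_
  simp only [Pi.pow_apply, Pi.mul_apply, Pi.sub_apply, ddv2, dv2]
  field_simp
  ring

lemma hasDerivAt_ddv2 (h : NormalizedLanger e β r K w v F F1 F2 F3) {z : ℝ}
    (hz : z ∈ Ioo (-(3 / 5 * e)) r) (hze : z ≠ e) :
    HasDerivAt (ddv2 β w v F1 F2) ((F3 z - 9 * v z ^ 2 * dv2 β w v F1 z -
      5 / 2 * w z * dv2 β w v F1 z ^ 2 / v z - 7 * w z * v z * ddv2 β w v F1 F2 z) /
        (w z ^ 2 - β ^ 2)) z := by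
  have he := h.e_pos
  have her := h.e_lt
  obtain ⟨-, -, hT, -, -, hv, hw, heq⟩ := h.pointwise hz hze
  have hT0 : w z ^ 2 - β ^ 2 ≠ 0 := right_ne_zero_of_mul hT.ne'
  have hv1 : HasDerivAt v (dv2 β w v F1 z / (2 * v z)) z := h.hasDerivAt_v hz hze
  have hP := h.hasDerivAt_dv2 hz hze
  have hd := (((h.F2_deriv z ⟨by linarith [hz.1], hz.2⟩).sub ((hv1.pow 4).const_mul 2)).sub
    (((hw.const_mul 5).mul hv1).mul hP)).div ((hw.pow 2).sub_const (β ^ 2)) hT0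
  refine hd.congr_deriv ?_
  have hS : F2 z = ddv2 β w v F1 F2 z * (w z ^ 2 - β ^ 2) + 2 * v z ^ 4 +
      5 * w z * v z * dv2 β w v F1 z := by
    rw [ddv2, div_mul_cancel₀ _ hT0]; ring
  simp only [Pi.pow_apply, Pi.mul_apply, Pi.sub_apply]
  generalize ddv2 β w v F1 F2 z = S at *
  generalize dv2 β w v F1 z = P at *
  rw [hS]
  field_simp
  ring

lemma hasDerivAt_w2 (h : NormalizedLanger e β r K w v F F1 F2 F3) {z : ℝ}
    (hz : z ∈ Ioo (-(3 / 5 * e)) r) (hze : z ≠ e) :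
    HasDerivAt (fun z => dv2 β w v F1 z / (2 * v z))
      (ddv2 β w v F1 F2 z / (2 * v z) - dv2 β w v F1 z ^ 2 / (4 * v z ^ 3)) z := by
  obtain ⟨-, -, hT, -, -, hv, hw, heq⟩ := h.pointwise hz hze
  have hv1 : HasDerivAt v (dv2 β w v F1 z / (2 * v z)) z := h.hasDerivAt_v hz hze
  refine ((h.hasDerivAt_dv2 hz hze).div (hv1.const_mul 2) (by positivity)).congr_deriv ?_
  field_simp
  ring

end NormalizedLanger

namespace NormalizedLanger

variable {e β r K : ℝ} {w v F F1 F2 F3 : ℝ → ℝ}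

lemma numerator_bounds (h : NormalizedLanger e β r K w v F F1 F2 F3) {z : ℝ}
    (hz : z ∈ Ioo (-(3 / 5 * e)) r) (hze : z ≠ e) :
    |w z| ≤ 101 / 100 * (|z| + e) ∧ |v z - 1| ≤ 1 / 1000 ∧
      |F1 z - 2 * w z * v z ^ 3| ≤ 4000 * (K * (|z| + e) ^ 2) * (|z| + e) ∧
      |F2 z - 2 * v z ^ 4| ≤ 4200 * (K * (|z| + e) ^ 2) := by
  have he := h.e_pos
  have her := h.e_lt
  have hK := h.K_nonneg
  have hzr : z ∈ Ioo (-r) r := ⟨by linarith [hz.1], hz.2⟩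
  obtain ⟨hκ, -, -, hv1, hwz, hv, -, -⟩ := h.pointwise hz hze
  have hF1 := h.F1_bound z hzr
  have hF2 := h.F2_bound z hzr
  have hzM : |z| ≤ |z| + e := by linarith
  have hM : 0 < |z| + e := by positivity
  generalize |z| + e = M at *
  have hκ0 : 0 ≤ K * M ^ 2 := by positivity
  have hF1' : |F1 z - 2 * z| ≤ K * M ^ 2 * M := by convert hF1 using 1; ring
  generalize K * M ^ 2 = κ at *
  have hw : |w z| ≤ 101 / 100 * M := by
    have h1 : |w z| ≤ |w z - z| + |z| := by simpa using abs_add_le (w z - z) z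
    have h2 : 200 * κ * M ≤ 200 * (1 / 10 ^ 6) * M := by gcongr
    linarith
  have hvs : |v z - 1| ≤ 1 / 1000 := by linarith
  have hv' := abs_le.1 hvs
  have hM0 : 0 ≤ κ * M := by positivity
  refine ⟨hw, hvs, ?_, ?_⟩
  · have h3 : |v z ^ 3 - 1| ≤ 1536 * κ := by
      rw [show v z ^ 3 - 1 = (v z - 1) * (v z ^ 2 + v z + 1) by ring, abs_mul,
        abs_of_pos (by positivity : 0 < v z ^ 2 + v z + 1)]
      calc |v z - 1| * (v z ^ 2 + v z + 1) ≤ 510 * κ * (301 / 100) := by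
            gcongr
            nlinarith
        _ ≤ _ := by linarith
    have h4 : |w z * (v z ^ 3 - 1)| ≤ 101 / 100 * M * (1536 * κ) := by
      rw [abs_mul]; gcongr
    rw [abs_le] at h4 hwz hF1' ⊢
    constructor <;> linarith
  · have h3 : |v z ^ 4 - 1| ≤ 2060 * κ := by
      rw [show v z ^ 4 - 1 = (v z - 1) * ((v z + 1) * (v z ^ 2 + 1)) by ring, abs_mul,
        abs_of_pos (by positivity : 0 < (v z + 1) * (v z ^ 2 + 1))]
      have h5 : (v z + 1) * (v z ^ 2 + 1) ≤ (2001 / 1000) * (2 + 1 / 100) := by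
        have : v z ^ 2 ≤ (1001 / 1000) ^ 2 := by gcongr; linarith
        exact mul_le_mul (by linarith) (by linarith) (by positivity) (by norm_num)
      calc |v z - 1| * ((v z + 1) * (v z ^ 2 + 1)) ≤ 510 * κ * ((2001 / 1000) * (2 + 1 / 100)) := by
            gcongr
        _ ≤ _ := by linarith
    rw [abs_le] at h3 hF2 ⊢
    constructor <;> linarith

lemma near_mem (h : NormalizedLanger e β r K w v F F1 F2 F3) {z t : ℝ}
    (hz : z ∈ Ico (e / 2) r) (ht : t ∈ uIcc e z) :
    t ∈ Ioo (-(3 / 5 * e)) r ∧ e / 2 ≤ t ∧ |t| + e ≤ 4 / 3 * (z + e) := by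
  have he := h.e_pos
  have her := h.e_lt
  have h1 := hz.1
  have h2 := hz.2
  rw [mem_uIcc] at ht
  rcases ht with ht | ht
  · rw [abs_of_nonneg (by linarith [ht.1])]
    exact ⟨⟨by linarith [ht.1], by linarith [ht.2]⟩, by linarith [ht.1], by linarith [ht.2]⟩
  · rw [abs_of_nonneg (by linarith [ht.1])]
    exact ⟨⟨by linarith [ht.1], by linarith [ht.2]⟩, by linarith [ht.1], by linarith [ht.2]⟩

lemma near_w_pos (h : NormalizedLanger e β r K w v F F1 F2 F3) {t : ℝ}
    (ht : t ∈ Ioo (-(3 / 5 * e)) r) (hte : t ≠ e) (ht2 : e / 2 ≤ t) : 0 < w t := by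
  have he := h.e_pos
  obtain ⟨hκ, -, -, -, hwz, -⟩ := h.pointwise ht hte
  have hM : 0 < |t| + e := by positivity
  have h1 : 200 * (K * (|t| + e) ^ 2) * (|t| + e) ≤ 200 * (1 / 10 ^ 6) * (|t| + e) := by gcongr
  have h2 := (abs_le.1 hwz).1
  rw [abs_of_nonneg (by linarith : 0 ≤ t)] at *
  linarith

/-- Applying the singular ODE estimate at the turning point `e`. -/
lemma near_singular (h : NormalizedLanger e β r K w v F F1 F2 F3) {z α Rm B : ℝ} {f f1 : ℝ → ℝ}
    (hz : z ∈ Ico (e / 2) r) (hze : z ≠ e) (hα : 1 < α) (hRm : 0 ≤ Rm)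
    (hf : ∀ t ∈ Ioo (-(3 / 5 * e)) r, t ≠ e → HasDerivAt f (f1 t) t)
    (hR : ∀ t ∈ uIcc e z, t ≠ e →
      |(w t ^ 2 - β ^ 2) * f1 t + α * (2 * w t * v t) * f t| ≤ Rm)
    (hB : ∀ t ∈ uIcc e z, t ≠ e → |(w t ^ 2 - β ^ 2) * f t| ≤ B) :
    |f z| * (z + e) ≤ 1002 / 1000 * Rm := by
  have he := h.e_pos
  have key := abs_le_of_singular_ode (a := e) (Z := z) (α := α) (Rm := Rm) (B := B)
    (T := fun t => w t ^ 2 - β ^ 2) (T1 := fun t => 2 * w t * v t) (f := f) (f1 := f1) hze hα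
    ((h.w_cont.pow 2).sub continuous_const).continuousOn (by simp [h.w_right])
    (fun t ht hte => by
      obtain ⟨-, -, -, -, -, -, hw, -⟩ := h.pointwise (h.near_mem hz ht).1 hte
      exact ((hw.pow 2).sub_const _).congr_deriv (by simp))
    (fun t ht hte => by
      obtain ⟨h1, h2, -⟩ := h.near_mem hz ht
      obtain ⟨-, -, -, -, -, hv, -, -⟩ := h.pointwise h1 hte
      have := h.near_w_pos h1 hte h2
      positivity)
    (fun t ht hte => (h.pointwise (h.near_mem hz ht).1 hte).2.2.1)
    (fun t ht hte => hf t (h.near_mem hz ht).1 hte) hR hB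
  obtain ⟨-, hT, hT', -⟩ := h.pointwise (z := z) ⟨by linarith [hz.1], hz.2⟩ hze
  have hz0 : 0 < z + e := by linarith [hz.1]
  have h1 : (z - e) / (w z ^ 2 - β ^ 2) * (z + e) ≤ 1002 / 1000 := by
    have : (z - e) / (w z ^ 2 - β ^ 2) = |z - e| / |w z ^ 2 - β ^ 2| := by
      rw [← abs_div, abs_of_pos]
      rcases pos_and_pos_or_neg_and_neg_of_mul_pos hT' with ⟨ha, hb⟩ | ⟨ha, hb⟩
      · exact div_pos ha hb
      · exact div_pos_of_neg_of_neg ha hb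
    have h0 : 0 < |w z ^ 2 - β ^ 2| := abs_pos.2 (right_ne_zero_of_mul hT'.ne')
    rw [this, div_mul_eq_mul_div, div_le_iff₀ h0]
    linarith
  calc |f z| * (z + e) ≤ Rm * ((z - e) / (w z ^ 2 - β ^ 2)) * (z + e) := by gcongr
    _ = Rm * ((z - e) / (w z ^ 2 - β ^ 2) * (z + e)) := by ring
    _ ≤ Rm * (1002 / 1000) := by gcongr
    _ = _ := by ring

lemma middle_T (h : NormalizedLanger e β r K w v F F1 F2 F3) {z : ℝ}
    (hz : z ∈ Ioo (-(3 / 5 * e)) r) (hz2 : z < e / 2) :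
    63 / 256 * (|z| + e) ^ 2 ≤ |w z ^ 2 - β ^ 2| := by
  have he := h.e_pos
  obtain ⟨-, hT, -⟩ := h.pointwise hz (by linarith)
  rw [abs_of_neg (by linarith : z - e < 0)] at hT
  have h1 : |z| ≤ 3 / 5 * e := abs_le.2 ⟨hz.1.le, by linarith⟩
  have h2 : (|z| + e) ^ 2 ≤ (8 / 5 * e) ^ 2 := by gcongr; linarith
  nlinarith [hz.1]

lemma dv2_mul (h : NormalizedLanger e β r K w v F F1 F2 F3) {z : ℝ}
    (hz : z ∈ Ioo (-(3 / 5 * e)) r) (hze : z ≠ e) :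
    (w z ^ 2 - β ^ 2) * dv2 β w v F1 z = F1 z - 2 * w z * v z ^ 3 := by
  obtain ⟨-, -, hT, -⟩ := h.pointwise hz hze
  rw [dv2, mul_div_cancel₀ _ (right_ne_zero_of_mul hT.ne')]

lemma ddv2_mul (h : NormalizedLanger e β r K w v F F1 F2 F3) {z : ℝ}
    (hz : z ∈ Ioo (-(3 / 5 * e)) r) (hze : z ≠ e) :
    (w z ^ 2 - β ^ 2) * ddv2 β w v F1 F2 z =
      F2 z - 2 * v z ^ 4 - 5 * w z * v z * dv2 β w v F1 z := by
  obtain ⟨-, -, hT, -⟩ := h.pointwise hz hze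
  rw [ddv2, mul_div_cancel₀ _ (right_ne_zero_of_mul hT.ne')]

lemma abs_dv2_le (h : NormalizedLanger e β r K w v F F1 F2 F3) {z : ℝ}
    (hz : z ∈ Ioo (-(3 / 5 * e)) r) (hze : z ≠ e) :
    |dv2 β w v F1 z| ≤ 17000 * K * (|z| + e) := by
  have he := h.e_pos
  have hK := h.K_nonneg
  rcases lt_or_ge z (e / 2) with hz2 | hz2
  · obtain ⟨-, -, hN, -⟩ := h.numerator_bounds hz hze
    have hT := h.middle_T hz hz2
    rw [← h.dv2_mul hz hze, abs_mul] at hN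
    have hM : 0 < |z| + e := by positivity
    generalize |z| + e = M at *
    have h1 : 63 / 256 * M ^ 2 * |dv2 β w v F1 z| ≤ 4000 * (K * M ^ 2) * M :=
      le_trans (by gcongr) hN
    apply le_of_mul_le_mul_left _ (by positivity : 0 < 63 / 256 * M ^ 2)
    have : 0 ≤ K * M ^ 2 * M := by positivity
    linarith
  · have hzI : z ∈ Ico (e / 2) r := ⟨hz2, hz.2⟩
    have hz0 : 0 < z + e := by linarith
    have hbd : ∀ t ∈ uIcc e z, (|t| + e) ^ 2 ≤ (4 / 3 * (z + e)) ^ 2 := fun t ht => by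
      have := (h.near_mem hzI ht).2.2
      gcongr
    have := h.near_singular (f := dv2 β w v F1) (f1 := ddv2 β w v F1 F2) (α := 5 / 2)
      (Rm := 4200 * (K * (4 / 3 * (z + e)) ^ 2))
      (B := 4000 * (K * (4 / 3 * (z + e)) ^ 2) * (4 / 3 * (z + e))) hzI hze (by norm_num)
      (by positivity) (fun t => h.hasDerivAt_dv2)
      (fun t ht hte => by
        obtain ⟨hm, -⟩ := h.near_mem hzI ht
        obtain ⟨-, -, -, hN⟩ := h.numerator_bounds hm hte
        rw [h.ddv2_mul hm hte]
        refine le_trans (le_of_eq ?_) (hN.trans ?_)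
        · congr 1; ring
        · have := hbd t ht
          gcongr)
      (fun t ht hte => by
        obtain ⟨hm, -, hm2⟩ := h.near_mem hzI ht
        obtain ⟨-, -, hN, -⟩ := h.numerator_bounds hm hte
        rw [h.dv2_mul hm hte]
        have := hbd t ht
        refine hN.trans ?_
        gcongr)
    rw [abs_of_nonneg (by linarith : 0 ≤ z)]
    apply le_of_mul_le_mul_right _ hz0
    have : 0 ≤ K * (z + e) ^ 2 := by positivity
    linarith

lemma abs_w_mul_dv2_le (h : NormalizedLanger e β r K w v F F1 F2 F3) {z : ℝ}
    (hz : z ∈ Ioo (-(3 / 5 * e)) r) (hze : z ≠ e) :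
    |w z * v z * dv2 β w v F1 z| ≤ 17200 * (K * (|z| + e) ^ 2) := by
  have he := h.e_pos
  have hK := h.K_nonneg
  obtain ⟨hw, hv, -⟩ := h.numerator_bounds hz hze
  have hP := h.abs_dv2_le hz hze
  have hv2 : |v z| ≤ 1001 / 1000 := by
    rw [abs_le] at hv ⊢
    constructor <;> linarith
  rw [abs_mul, abs_mul]
  have hM : 0 < |z| + e := by positivity
  calc |w z| * |v z| * |dv2 β w v F1 z|
      ≤ 101 / 100 * (|z| + e) * (1001 / 1000) * (17000 * K * (|z| + e)) := by gcongr
    _ ≤ _ := by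
      have : 0 ≤ K * (|z| + e) ^ 2 := by positivity
      linarith

lemma abs_ddv2_mul_le (h : NormalizedLanger e β r K w v F F1 F2 F3) {z : ℝ}
    (hz : z ∈ Ioo (-(3 / 5 * e)) r) (hze : z ≠ e) :
    |(w z ^ 2 - β ^ 2) * ddv2 β w v F1 F2 z| ≤ 91000 * (K * (|z| + e) ^ 2) := by
  rw [h.ddv2_mul hz hze]
  have he := h.e_pos
  have hK := h.K_nonneg
  have : 0 ≤ K * (|z| + e) ^ 2 := by positivity
  have h1 := h.abs_w_mul_dv2_le hz hze
  obtain ⟨-, -, -, hN⟩ := h.numerator_bounds hz hze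
  rw [abs_le] at *
  constructor <;> linarith

lemma abs_ddv2_le (h : NormalizedLanger e β r K w v F F1 F2 F3) {z : ℝ}
    (hz : z ∈ Ioo (-(3 / 5 * e)) r) (hze : z ≠ e) :
    |ddv2 β w v F1 F2 z| ≤ 400000 * K := by
  have he := h.e_pos
  have hK := h.K_nonneg
  rcases lt_or_ge z (e / 2) with hz2 | hz2
  · have hN := h.abs_ddv2_mul_le hz hze
    have hT := h.middle_T hz hz2
    rw [abs_mul] at hN
    have hM : 0 < |z| + e := by positivity
    generalize |z| + e = M at *
    have h1 : 63 / 256 * M ^ 2 * |ddv2 β w v F1 F2 z| ≤ 91000 * (K * M ^ 2) :=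
      le_trans (by gcongr) hN
    apply le_of_mul_le_mul_left _ (by positivity : 0 < 63 / 256 * M ^ 2)
    have : 0 ≤ K * M ^ 2 := by positivity
    linarith
  · have hzI : z ∈ Ico (e / 2) r := ⟨hz2, hz.2⟩
    have hz0 : 0 < z + e := by linarith
    have := h.near_singular (f := ddv2 β w v F1 F2) (f1 := _) (α := 7 / 2)
      (Rm := 155000 * (K * (4 / 3 * (z + e))))
      (B := 91000 * (K * (4 / 3 * (z + e)) ^ 2)) hzI hze (by norm_num)
      (by positivity) (fun t => h.hasDerivAt_ddv2)
      (fun t ht hte => by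
        obtain ⟨hm, -, hm2⟩ := h.near_mem hzI ht
        obtain ⟨hκ, -, hT, -, -, hv0, -⟩ := h.pointwise hm hte
        obtain ⟨hw, hv, -⟩ := h.numerator_bounds hm hte
        have hP := h.abs_dv2_le hm hte
        have hF3 := h.F3_bound t ⟨by linarith [hm.1, h.e_lt], hm.2⟩
        rw [mul_div_cancel₀ _ (right_ne_zero_of_mul hT.ne')]
        have hM : 0 < |t| + e := by positivity
        refine le_trans ?_ (by gcongr : 155000 * (K * (|t| + e)) ≤ _)
        generalize dv2 β w v F1 t = P at *
        generalize ddv2 β w v F1 F2 t = S at *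
        generalize |t| + e = M at *
        have hv' := abs_le.1 hv
        have h1 : |v t ^ 2 * P| ≤ 10021 / 10000 * (17000 * K * M) := by
          rw [abs_mul, abs_of_nonneg (by positivity : 0 ≤ v t ^ 2)]
          gcongr
          nlinarith
        have h2 : |w t * P ^ 2 / v t| ≤ 300 * (K * M) := by
          rw [abs_div, abs_mul, abs_of_pos hv0, div_le_iff₀ hv0, abs_pow]
          calc |w t| * |P| ^ 2 ≤ 101 / 100 * M * (17000 * K * M) ^ 2 := by gcongr
            _ = 101 / 100 * 17000 ^ 2 * (K * M ^ 2) * (K * M) := by ring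
            _ ≤ 101 / 100 * 17000 ^ 2 * (1 / 10 ^ 6) * (K * M) := by gcongr
            _ ≤ 300 * (K * M) * (999 / 1000) := by
              have : 0 ≤ K * M := by positivity
              linarith
            _ ≤ _ := by gcongr; linarith
        have h3 : F3 t - 9 * v t ^ 2 * P - 5 / 2 * w t * P ^ 2 / v t - 7 * w t * v t * S +
            7 / 2 * (2 * w t * v t) * S =
            F3 t - 9 * (v t ^ 2 * P) - 5 / 2 * (w t * P ^ 2 / v t) := by ring
        rw [h3]
        have : 0 ≤ K * M := by positivity
        rw [abs_le] at *
        constructor <;> linarith)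
      (fun t ht hte => by
        obtain ⟨hm, -, hm2⟩ := h.near_mem hzI ht
        refine (h.abs_ddv2_mul_le hm hte).trans ?_
        gcongr)
    apply le_of_mul_le_mul_right _ hz0
    have : 0 ≤ K * (z + e) := by positivity
    linarith

/-- The first three derivatives of a normalised Langer solution are bounded. -/
theorem deriv_bounds (h : NormalizedLanger e β r K w v F F1 F2 F3) :
    ∃ w2 w3 : ℝ → ℝ, ∀ z ∈ Ioo (-(3 / 5 * e)) r, z ≠ e →
      HasDerivAt w (v z) z ∧ HasDerivAt v (w2 z) z ∧ HasDerivAt w2 (w3 z) z ∧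
      |v z| ≤ 2 ∧ |w2 z| ≤ 9000 * K * (2 * r) ∧ |w3 z| ≤ 300000 * K := by
  refine ⟨fun z => dv2 β w v F1 z / (2 * v z), fun z => ddv2 β w v F1 F2 z / (2 * v z) -
    dv2 β w v F1 z ^ 2 / (4 * v z ^ 3), fun z hz hze => ?_⟩
  have he := h.e_pos
  have her := h.e_lt
  have hK := h.K_nonneg
  have hP := h.abs_dv2_le hz hze
  have hS := h.abs_ddv2_le hz hze
  obtain ⟨-, hv, -⟩ := h.numerator_bounds hz hze
  obtain ⟨hκ, -, -, -, -, hv0, hw, -⟩ := h.pointwise hz hze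
  have hv' := abs_le.1 hv
  have habs : |z| ≤ r := abs_le.2 ⟨by linarith [hz.1], hz.2.le⟩
  refine ⟨hw, h.hasDerivAt_v hz hze, h.hasDerivAt_w2 hz hze, ?_, ?_, ?_⟩
  · rw [abs_of_pos hv0]; linarith
  · change |dv2 β w v F1 z / (2 * v z)| ≤ _
    rw [abs_div, abs_of_pos (by positivity : 0 < 2 * v z), div_le_iff₀ (by positivity)]
    have h1 : 9000 * K * (2 * r) * (2 * (999 / 1000)) ≤ 9000 * K * (2 * r) * (2 * v z) := by
      have : 0 ≤ r := by linarith
      gcongr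
      linarith
    have h2 : K * (|z| + e) ≤ K * (2 * r) := by gcongr; linarith
    have h3 : 0 ≤ K * (2 * r) := mul_nonneg hK (by linarith)
    linarith
  · have hM : 0 < |z| + e := by positivity
    have h1 : |ddv2 β w v F1 F2 z / (2 * v z)| ≤ 210000 * K := by
      rw [abs_div, abs_of_pos (by positivity : 0 < 2 * v z), div_le_iff₀ (by positivity)]
      have : 210000 * K * (2 * (999 / 1000)) ≤ 210000 * K * (2 * v z) := by
        gcongr
        linarith
      linarith
    have h2 : |dv2 β w v F1 z ^ 2 / (4 * v z ^ 3)| ≤ 300 * K := by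
      rw [abs_div, abs_of_pos (by positivity : 0 < 4 * v z ^ 3), div_le_iff₀ (by positivity),
        abs_pow]
      have h3 : 300 * K * (4 * (999 / 1000) ^ 3) ≤ 300 * K * (4 * v z ^ 3) := by
        gcongr
        linarith
      have h4 : |dv2 β w v F1 z| ^ 2 ≤ (17000 * K * (|z| + e)) ^ 2 := by gcongr
      have h5 : (17000 * K * (|z| + e)) ^ 2 = 17000 ^ 2 * (K * (|z| + e) ^ 2) * K := by ring
      have h6 : 17000 ^ 2 * (K * (|z| + e) ^ 2) * K ≤ 17000 ^ 2 * (1 / 10 ^ 6) * K := by gcongr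
      linarith
    have h7 := abs_sub (ddv2 β w v F1 F2 z / (2 * v z)) (dv2 β w v F1 z ^ 2 / (4 * v z ^ 3))
    linarith

end NormalizedLanger

/-- A bound for the third derivative away from one point `p` persists at `p`. -/
lemma abs_iteratedDeriv_three_le {g g1 g2 g3 : ℝ → ℝ} {a b p C : ℝ} (hC : 0 ≤ C)
    (h1 : ∀ x ∈ Ioo a b, x ≠ p → HasDerivAt g (g1 x) x)
    (h2 : ∀ x ∈ Ioo a b, x ≠ p → HasDerivAt g1 (g2 x) x)
    (h3 : ∀ x ∈ Ioo a b, x ≠ p → HasDerivAt g2 (g3 x) x)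
    (hb : ∀ x ∈ Ioo a b, x ≠ p → |g3 x| ≤ C) {x : ℝ} (hx : x ∈ Ioo a b) :
    |iteratedDeriv 3 g x| ≤ C := by
  have hnear : ∀ x ∈ Ioo a b, x ≠ p → ∀ᶠ y in nhds x, y ∈ Ioo a b ∧ y ≠ p := fun x hx hxp => by
    filter_upwards [isOpen_Ioo.mem_nhds hx, isOpen_ne.mem_nhds hxp] with y hy hyp
    exact ⟨hy, hyp⟩
  have hd1 : ∀ x ∈ Ioo a b, x ≠ p → iteratedDeriv 1 g x = g1 x := fun x hx hxp => by
    rw [iteratedDeriv_one, (h1 x hx hxp).deriv]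
  have hd2 : ∀ x ∈ Ioo a b, x ≠ p → iteratedDeriv 2 g x = g2 x := fun x hx hxp => by
    rw [iteratedDeriv_succ, Filter.EventuallyEq.deriv_eq (f := g1), (h2 x hx hxp).deriv]
    filter_upwards [hnear x hx hxp] with y hy using hd1 y hy.1 hy.2
  have hd3 : ∀ x ∈ Ioo a b, x ≠ p → HasDerivAt (iteratedDeriv 2 g) (g3 x) x := fun x hx hxp => by
    refine (h3 x hx hxp).congr_of_eventuallyEq ?_
    filter_upwards [hnear x hx hxp] with y hy using hd2 y hy.1 hy.2
  rw [iteratedDeriv_succ]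
  rcases ne_or_eq x p with hxp | rfl
  · rw [(hd3 x hx hxp).deriv]
    exact hb x hx hxp
  by_cases hdiff : DifferentiableAt ℝ (iteratedDeriv 2 g) x
  swap
  · rwa [deriv_zero_of_not_differentiableAt hdiff, abs_zero]
  have hcont : ∀ y ∈ Ioo a b, ContinuousAt (iteratedDeriv 2 g) y := fun y hy => by
    rcases ne_or_eq y x with hyp | rfl
    · exact (hd3 y hy hyp).continuousAt
    · exact hdiff.continuousAt
  rw [← Real.norm_eq_abs]
  apply norm_deriv_le_of_lip' hC
  filter_upwards [isOpen_Ioo.mem_nhds hx] with y hy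
  rcases lt_trichotomy y x with hlt | rfl | hlt
  · obtain ⟨t, ht, hs⟩ := exists_hasDerivAt_eq_slope (iteratedDeriv 2 g) g3 hlt
      (fun t ht => (hcont t ⟨hy.1.trans_le ht.1, ht.2.trans_lt hx.2⟩).continuousWithinAt)
      (fun t ht => hd3 t ⟨hy.1.trans ht.1, ht.2.trans hx.2⟩ ht.2.ne)
    have := hb t ⟨hy.1.trans ht.1, ht.2.trans hx.2⟩ ht.2.ne
    rw [hs, abs_div, div_le_iff₀ (abs_pos.2 (sub_ne_zero.2 hlt.ne'))] at this
    rwa [norm_sub_rev, norm_sub_rev y]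
  · simp
  · obtain ⟨t, ht, hs⟩ := exists_hasDerivAt_eq_slope (iteratedDeriv 2 g) g3 hlt
      (fun t ht => (hcont t ⟨hx.1.trans_le ht.1, ht.2.trans_lt hy.2⟩).continuousWithinAt)
      (fun t ht => hd3 t ⟨hx.1.trans ht.1, ht.2.trans hy.2⟩ ht.1.ne')
    have := hb t ⟨hx.1.trans ht.1, ht.2.trans hy.2⟩ ht.1.ne'
    rwa [hs, abs_div, div_le_iff₀ (abs_pos.2 (sub_ne_zero.2 hlt.ne'))] at this

/-- The inverse of `z ↦ z + γ z²` near the origin. -/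
noncomputable def quadInv (γ y : ℝ) : ℝ := 2 * y / (1 + √(1 + 4 * γ * y))

lemma one_add_quadInv {γ y : ℝ} (hy : 0 < 1 + 4 * γ * y) :
    1 + 2 * γ * quadInv γ y = √(1 + 4 * γ * y) := by
  have hs := Real.sq_sqrt hy.le
  have hs0 := Real.sqrt_pos.2 hy
  rw [quadInv]
  generalize √(1 + 4 * γ * y) = s at *
  field_simp
  linarith

lemma quadInv_add_sq {γ y : ℝ} (hy : 0 < 1 + 4 * γ * y) :
    quadInv γ y + γ * quadInv γ y ^ 2 = y := by
  have hs := Real.sq_sqrt hy.le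
  have hs0 := Real.sqrt_pos.2 hy
  rw [quadInv]
  generalize √(1 + 4 * γ * y) = s at *
  field_simp
  linear_combination (-y) * hs

lemma hasDerivAt_quadInv {γ y : ℝ} (hy : 0 < 1 + 4 * γ * y) :
    HasDerivAt (quadInv γ) (1 / (1 + 2 * γ * quadInv γ y)) y := by
  rw [one_add_quadInv hy]
  have hs := Real.sq_sqrt hy.le
  have hs0 := Real.sqrt_pos.2 hy
  have h1 : HasDerivAt (fun y => 1 + 4 * γ * y) (4 * γ) y := by
    simpa using ((hasDerivAt_id y).const_mul (4 * γ)).const_add 1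
  have h2 := ((hasDerivAt_id y).const_mul 2).div ((h1.sqrt hy.ne').const_add 1) (by positivity)
  refine h2.congr_deriv ?_
  simp only [id]
  field_simp
  linear_combination hs

/-- `quadInv` preserves order. -/
lemma lt_quadInv_iff {γ y a : ℝ} (hy : 0 < 1 + 4 * γ * y) (ha : 0 < 1 + 2 * γ * a) :
    a < quadInv γ y ↔ a + γ * a ^ 2 < y := by
  have h1 := one_add_quadInv hy
  have h2 := quadInv_add_sq hy
  have hs0 := Real.sqrt_pos.2 hy
  have h3 : y - (a + γ * a ^ 2) = (quadInv γ y - a) * (1 + γ * (quadInv γ y + a)) := by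
    linear_combination -h2
  have h4 : 0 < 1 + γ * (quadInv γ y + a) := by linarith
  rw [← sub_pos, ← sub_pos (b := a + γ * a ^ 2), h3, mul_pos_iff_of_pos_right h4]

lemma quadInv_lt_iff {γ y a : ℝ} (hy : 0 < 1 + 4 * γ * y) (ha : 0 < 1 + 2 * γ * a) :
    quadInv γ y < a ↔ y < a + γ * a ^ 2 := by
  have h1 := one_add_quadInv hy
  have h2 := quadInv_add_sq hy
  have hs0 := Real.sqrt_pos.2 hy
  have h3 : a + γ * a ^ 2 - y = (a - quadInv γ y) * (1 + γ * (quadInv γ y + a)) := by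
    linear_combination h2
  have h4 : 0 < 1 + γ * (quadInv γ y + a) := by linarith
  rw [← sub_pos, ← sub_pos (b := y), h3, mul_pos_iff_of_pos_right h4]

namespace NormalizedLanger

variable {e β r K : ℝ} {w v F F1 F2 F3 : ℝ → ℝ}

/-- Transfer of the derivative bounds through a quadratic change of variables. -/
theorem abs_iteratedDeriv_three_le (h : NormalizedLanger e β r K w v F F1 F2 F3)
    {g : ℝ → ℝ} {k c γ : ℝ} (hk : 0 < k) (hγ : |γ| * r ≤ 1 / 8)
    (hg : ∀ z, w z = k * g (c + z + γ * (z ^ 2 - e ^ 2))) {x : ℝ}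
    (hx : x ∈ Ioo (c - 3 / 5 * e - 16 / 25 * γ * e ^ 2) (c + r + γ * (r ^ 2 - e ^ 2))) :
    |iteratedDeriv 3 g x| ≤ 6 * (600000 * K + 144000 * |γ| * (K * r) + 24 * γ ^ 2) / k := by
  have he := h.e_pos
  have her := h.e_lt
  have hK := h.K_nonneg
  have hr : 0 < r := by linarith
  obtain ⟨w2, w3, hD⟩ := h.deriv_bounds
  set y : ℝ → ℝ := fun x => x - c + γ * e ^ 2 with hy
  have hγr := abs_le.1 (show |γ * r| ≤ 1 / 8 by rwa [abs_mul, abs_of_pos hr])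
  have hγz : ∀ z ∈ Icc (-r) r, 3 / 4 ≤ 1 + 2 * γ * z ∧ 1 + 2 * γ * z ≤ 5 / 4 := by
    intro z hz
    have : |γ * z| ≤ 1 / 8 := by
      rw [abs_mul]
      exact (mul_le_mul_of_nonneg_left (abs_le.2 hz) (abs_nonneg _)).trans hγ
    rw [abs_le] at this
    constructor <;> linarith
  have hypos : ∀ x ∈ Ioo (c - 3 / 5 * e - 16 / 25 * γ * e ^ 2) (c + r + γ * (r ^ 2 - e ^ 2)),
      0 < 1 + 4 * γ * y x := by
    intro x hx
    have h1 : γ * r ^ 2 ≤ 1 / 8 * r := by nlinarith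
    have h2 : |γ * e ^ 2| ≤ 1 / 8 * e := by
      rw [abs_mul, abs_of_pos (by positivity : 0 < e ^ 2)]
      nlinarith [abs_nonneg γ, mul_le_mul_of_nonneg_left her.le (abs_nonneg γ)]
    have h2' := abs_le.1 h2
    have h3 : |y x| ≤ 9 / 8 * r := by
      rw [abs_le, hy]
      constructor <;> linarith [hx.1, hx.2]
    have h4 : |γ * y x| ≤ 9 / 64 := by
      rw [abs_mul]
      calc |γ| * |y x| ≤ |γ| * (9 / 8 * r) := by gcongr
        _ ≤ _ := by linarith
    linarith [(abs_le.1 h4).1]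
  set ψ : ℝ → ℝ := fun x => quadInv γ (y x) with hψ
  have hmem : ∀ x ∈ Ioo (c - 3 / 5 * e - 16 / 25 * γ * e ^ 2) (c + r + γ * (r ^ 2 - e ^ 2)),
      ψ x ∈ Ioo (-(3 / 5 * e)) r := by
    intro x hx
    constructor
    · rw [hψ, lt_quadInv_iff (hypos x hx)]
      · simp only [hy]
        linarith [hx.1]
      · linarith [(hγz (-(3 / 5 * e)) ⟨by linarith, by linarith⟩).1]
    · rw [hψ, quadInv_lt_iff (hypos x hx)]
      · simp only [hy]
        linarith [hx.2]
      · linarith [(hγz r ⟨by linarith, by linarith⟩).1]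
  have hχψ : ∀ x ∈ Ioo (c - 3 / 5 * e - 16 / 25 * γ * e ^ 2) (c + r + γ * (r ^ 2 - e ^ 2)),
      c + ψ x + γ * (ψ x ^ 2 - e ^ 2) = x := by
    intro x hx
    have h1 := quadInv_add_sq (hypos x hx)
    simp only [hψ]
    simp only [hy] at h1 ⊢
    linarith
  have hne : ∀ x ∈ Ioo (c - 3 / 5 * e - 16 / 25 * γ * e ^ 2) (c + r + γ * (r ^ 2 - e ^ 2)),
      x ≠ c + e → ψ x ≠ e := by
    intro x hx hxe hψe
    apply hxe
    have := hχψ x hx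
    rw [hψe] at this
    linarith
  have hu : ∀ x ∈ Ioo (c - 3 / 5 * e - 16 / 25 * γ * e ^ 2) (c + r + γ * (r ^ 2 - e ^ 2)),
      3 / 4 ≤ 1 + 2 * γ * ψ x ∧ 1 + 2 * γ * ψ x ≤ 5 / 4 := fun x hx =>
    hγz _ ⟨by linarith [(hmem x hx).1], (hmem x hx).2.le⟩
  have hψd : ∀ x ∈ Ioo (c - 3 / 5 * e - 16 / 25 * γ * e ^ 2) (c + r + γ * (r ^ 2 - e ^ 2)),
      HasDerivAt ψ (1 / (1 + 2 * γ * ψ x)) x := by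
    intro x hx
    have h1 : HasDerivAt y 1 x := ((hasDerivAt_id x).sub_const c).add_const (γ * e ^ 2)
    exact ((hasDerivAt_quadInv (hypos x hx)).comp x h1).congr_deriv (by simp [hψ])
  have hud : ∀ z, HasDerivAt (fun z => 1 + 2 * γ * z) (2 * γ) z := fun z => by
    simpa using ((hasDerivAt_id z).const_mul (2 * γ)).const_add 1
  apply _root_.abs_iteratedDeriv_three_le (p := c + e)
    (g1 := fun x => v (ψ x) / (1 + 2 * γ * ψ x) / k)
    (g2 := fun x => (w2 (ψ x) * (1 + 2 * γ * ψ x) - 2 * γ * v (ψ x)) /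
      (1 + 2 * γ * ψ x) ^ 3 / k)
    (g3 := fun x => (w3 (ψ x) * (1 + 2 * γ * ψ x) ^ 2 - 6 * γ * (1 + 2 * γ * ψ x) * w2 (ψ x) +
      12 * γ ^ 2 * v (ψ x)) / (1 + 2 * γ * ψ x) ^ 5 / k) (by positivity) _ _ _ _ hx
  · intro x hx hxe
    obtain ⟨h1, -⟩ := hD (ψ x) (hmem x hx) (hne x hx hxe)
    have h2 := (h1.comp x (hψd x hx)).div_const k
    refine (h2.congr_of_eventuallyEq ?_).congr_deriv (by ring)
    filter_upwards [isOpen_Ioo.mem_nhds hx] with x' hx'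
    simp only [Function.comp, hg, hχψ x' hx']
    field_simp
  · intro x hx hxe
    obtain ⟨-, h1, -⟩ := hD (ψ x) (hmem x hx) (hne x hx hxe)
    have hu0 : 0 < 1 + 2 * γ * ψ x := by linarith [(hu x hx).1]
    have h2 := ((h1.div (hud (ψ x)) hu0.ne').comp x (hψd x hx)).div_const k
    refine h2.congr_deriv ?_
    field_simp
  · intro x hx hxe
    obtain ⟨-, h1, h2, -⟩ := hD (ψ x) (hmem x hx) (hne x hx hxe)
    have hu0 : 0 < 1 + 2 * γ * ψ x := by linarith [(hu x hx).1]
    have h3 := ((((h2.mul (hud (ψ x))).sub (h1.const_mul (2 * γ))).div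
      ((hud (ψ x)).pow 3) (pow_pos hu0 3).ne').comp x (hψd x hx)).div_const k
    refine h3.congr_deriv ?_
    simp only [Pi.pow_apply, Pi.mul_apply, Pi.sub_apply]
    field_simp
    ring
  · intro x hx hxe
    obtain ⟨-, -, -, hv, hw2, hw3⟩ := hD (ψ x) (hmem x hx) (hne x hx hxe)
    obtain ⟨hu1, hu2⟩ := hu x hx
    generalize 1 + 2 * γ * ψ x = u at *
    have hu0 : 0 < u := by linarith
    rw [abs_div, abs_div, abs_of_pos hk, abs_of_pos (pow_pos hu0 5)]
    gcongr
    rw [div_le_iff₀ (by positivity)]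
    have h5 : (1 : ℝ) ≤ 6 * u ^ 5 := by
      have : 6 * (3 / 4) ^ 5 ≤ 6 * u ^ 5 := by gcongr
      linarith
    have h6 : |w3 (ψ x) * u ^ 2 - 6 * γ * u * w2 (ψ x) + 12 * γ ^ 2 * v (ψ x)| ≤
        600000 * K + 144000 * |γ| * (K * r) + 24 * γ ^ 2 := by
      have a1 : |w3 (ψ x) * u ^ 2| ≤ 300000 * K * (5 / 4) ^ 2 := by
        rw [abs_mul, abs_of_pos (pow_pos hu0 2)]
        gcongr
      have a2 : |6 * γ * u * w2 (ψ x)| ≤ 6 * |γ| * (5 / 4) * (9000 * K * (2 * r)) := by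
        rw [abs_mul, abs_mul, abs_mul, abs_of_pos hu0]
        gcongr
        norm_num
      have a3 : |12 * γ ^ 2 * v (ψ x)| ≤ 12 * γ ^ 2 * 2 := by
        rw [abs_mul, abs_of_nonneg (by positivity : 0 ≤ 12 * γ ^ 2)]
        gcongr
      have : 0 ≤ |γ| * (K * r) := by positivity
      have a4 := abs_add_le (w3 (ψ x) * u ^ 2 - 6 * γ * u * w2 (ψ x)) (12 * γ ^ 2 * v (ψ x))
      have a5 := abs_sub (w3 (ψ x) * u ^ 2) (6 * γ * u * w2 (ψ x))
      linarith
    have h7 : 0 ≤ 600000 * K + 144000 * |γ| * (K * r) + 24 * γ ^ 2 := by positivity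
    generalize 600000 * K + 144000 * |γ| * (K * r) + 24 * γ ^ 2 = B at *
    nlinarith

end NormalizedLanger

lemma abs_sub_le_of_hasDerivAt {f f' : ℝ → ℝ} {a b B : ℝ}
    (hf : ∀ t ∈ uIcc a b, HasDerivAt f (f' t) t) (hB : ∀ t ∈ uIcc a b, |f' t| ≤ B) :
    |f b - f a| ≤ B * |b - a| :=
  (convex_uIcc a b).norm_image_sub_le_of_norm_hasDerivWithin_le
    (fun t ht => (hf t ht).hasDerivWithinAt) hB left_mem_uIcc right_mem_uIcc

lemma abs_le_pow_of_hasDerivAt {f f' : ℝ → ℝ} {C D x : ℝ} (n : ℕ) (hC : 0 ≤ C) (hx : |x| ≤ D)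
    (hf : ∀ t, |t| ≤ D → HasDerivAt f (f' t) t) (hf0 : f 0 = 0)
    (hf' : ∀ t, |t| ≤ D → |f' t| ≤ C * |t| ^ n) : |f x| ≤ C * |x| ^ (n + 1) := by
  have hm : ∀ t ∈ uIcc 0 x, |t| ≤ |x| := fun t ht => by
    simpa using abs_sub_left_of_mem_uIcc ht
  have := abs_sub_le_of_hasDerivAt (f := f) (f' := f') (a := 0) (b := x) (B := C * |x| ^ n)
    (fun t ht => hf t ((hm t ht).trans hx)) (fun t ht => (hf' t ((hm t ht).trans hx)).trans (by
      have := hm t ht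
      gcongr))
  rw [hf0, sub_zero, sub_zero] at this
  rw [pow_succ, ← mul_assoc]
  exact this

/-- A potential well with non-degenerate minimum at `0`, together with its first four derivatives
and quantitative bounds. -/
structure WellData (a0 K0 D : ℝ) (V0 V1 V2 V3 V4 : ℝ → ℝ) : Prop where
  a0_pos : 0 < a0
  V0_deriv : ∀ x, HasDerivAt V0 (V1 x) x
  V1_deriv : ∀ x, HasDerivAt V1 (V2 x) x
  V2_deriv : ∀ x, HasDerivAt V2 (V3 x) x
  V3_deriv : ∀ x, HasDerivAt V3 (V4 x) x
  V2_bound : ∀ x, |x| ≤ D → |V2 x| ≤ K0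
  V3_bound : ∀ x, |x| ≤ D → |V3 x| ≤ K0
  V4_bound : ∀ x, |x| ≤ D → |V4 x| ≤ K0
  V0_zero : V0 0 = 0
  V1_zero : V1 0 = 0
  le_V2_zero : a0 ≤ V2 0
  V1_pos : ∀ x, 0 < x → 0 < V1 x
  V1_neg : ∀ x, x < 0 → V1 x < 0

namespace WellData

variable {a0 K0 D : ℝ} {V0 V1 V2 V3 V4 : ℝ → ℝ}

lemma K0_nonneg (h : WellData a0 K0 D V0 V1 V2 V3 V4) (hD : 0 ≤ D) : 0 ≤ K0 :=
  (abs_nonneg _).trans (h.V2_bound 0 (by simpa using hD))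

lemma V2_zero_le (h : WellData a0 K0 D V0 V1 V2 V3 V4) (hD : 0 ≤ D) : V2 0 ≤ K0 :=
  (le_abs_self _).trans (h.V2_bound 0 (by simpa using hD))

lemma abs_V3_sub_le (h : WellData a0 K0 D V0 V1 V2 V3 V4) {x : ℝ} (hx : |x| ≤ D) :
    |V3 x - V3 0| ≤ K0 * |x| := by
  have hK := h.K0_nonneg ((abs_nonneg x).trans hx)
  simpa using abs_le_pow_of_hasDerivAt (f := fun x => V3 x - V3 0) 0 hK hx
    (fun t _ => (h.V3_deriv t).sub_const _) (by simp) (fun t ht => by simpa using h.V4_bound t ht)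

lemma abs_V2_sub_le (h : WellData a0 K0 D V0 V1 V2 V3 V4) {x : ℝ} (hx : |x| ≤ D) :
    |V2 x - V2 0| ≤ K0 * |x| := by
  have hK := h.K0_nonneg ((abs_nonneg x).trans hx)
  simpa using abs_le_pow_of_hasDerivAt (f := fun x => V2 x - V2 0) 0 hK hx
    (fun t _ => (h.V2_deriv t).sub_const _) (by simp) (fun t ht => by simpa using h.V3_bound t ht)

lemma abs_V1_le (h : WellData a0 K0 D V0 V1 V2 V3 V4) {x : ℝ} (hx : |x| ≤ D) :
    |V1 x| ≤ K0 * |x| := by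
  have hK := h.K0_nonneg ((abs_nonneg x).trans hx)
  simpa using abs_le_pow_of_hasDerivAt (f := V1) 0 hK hx
    (fun t _ => h.V1_deriv t) h.V1_zero (fun t ht => by simpa using h.V2_bound t ht)

lemma abs_V0_le (h : WellData a0 K0 D V0 V1 V2 V3 V4) {x : ℝ} (hx : |x| ≤ D) :
    |V0 x| ≤ K0 * |x| ^ 2 :=
  abs_le_pow_of_hasDerivAt (f := V0) 1 (h.K0_nonneg ((abs_nonneg x).trans hx)) hx
    (fun t _ => h.V0_deriv t) h.V0_zero (fun t ht => by simpa using h.abs_V1_le ht)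

lemma abs_V0_sub_le (h : WellData a0 K0 D V0 V1 V2 V3 V4) {x : ℝ} (hx : |x| ≤ D) :
    |V0 x - V2 0 * x ^ 2 / 2| ≤ K0 * |x| ^ 3 := by
  have hK := h.K0_nonneg ((abs_nonneg x).trans hx)
  have h1 : ∀ t, |t| ≤ D → |V1 t - V2 0 * t| ≤ K0 * |t| ^ 2 := fun t ht =>
    abs_le_pow_of_hasDerivAt (f := fun x => V1 x - V2 0 * x) 1 hK ht
      (fun t _ => (h.V1_deriv t).sub ((hasDerivAt_id t).const_mul (V2 0))) (by simp [h.V1_zero])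
      (fun t ht => by simpa using h.abs_V2_sub_le ht)
  exact abs_le_pow_of_hasDerivAt (f := fun x => V0 x - V2 0 * x ^ 2 / 2) 2 hK hx
    (fun t _ => by
      have := (h.V0_deriv t).sub (((hasDerivAt_pow 2 t).const_mul (V2 0)).div_const 2)
      exact this.congr_deriv (by push_cast; ring)) (by simp [h.V0_zero]) h1

lemma le_V0 (h : WellData a0 K0 D V0 V1 V2 V3 V4) {x : ℝ} (hx : |x| ≤ D)
    (hx2 : K0 * |x| ≤ a0 / 4) : a0 / 4 * x ^ 2 ≤ V0 x := by
  have h1 := (abs_le.1 (h.abs_V0_sub_le hx)).1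
  have h2 : K0 * |x| ^ 3 ≤ a0 / 4 * x ^ 2 := by
    rw [← sq_abs x]
    have := mul_le_mul_of_nonneg_right hx2 (sq_nonneg |x|)
    linarith
  have h3 : a0 * x ^ 2 ≤ V2 0 * x ^ 2 := by
    gcongr
    exact h.le_V2_zero
  linarith

/-- Points at low energy are close to the minimum. -/
lemma abs_lt_of_V0_eq (h : WellData a0 K0 D V0 V1 V2 V3 V4) {ρ lam x : ℝ} (hρ : 0 < ρ)
    (hρD : ρ ≤ D) (hρK : K0 * ρ ≤ a0 / 4) (hlam : lam ≤ a0 / 4 * ρ ^ 2) (hx : V0 x = lam) :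
    |x| ≤ ρ := by
  have hmono : StrictMonoOn V0 (Ici 0) := by
    apply strictMonoOn_of_deriv_pos (convex_Ici 0)
      (fun x _ => (h.V0_deriv x).continuousAt.continuousWithinAt)
    intro x hx
    rw [interior_Ici] at hx
    rw [(h.V0_deriv x).deriv]
    exact h.V1_pos x hx
  have hanti : StrictAntiOn V0 (Iic 0) := by
    apply strictAntiOn_of_deriv_neg (convex_Iic 0)
      (fun x _ => (h.V0_deriv x).continuousAt.continuousWithinAt)
    intro x hx
    rw [interior_Iic] at hx
    rw [(h.V0_deriv x).deriv]
    exact h.V1_neg x hx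
  have habs : |ρ| = ρ := abs_of_pos hρ
  rw [abs_le]
  constructor
  · by_contra! hlt
    have h1 := hanti (a := x) (b := -ρ) (by simp; linarith) (by simp; linarith) hlt
    have h2 := h.le_V0 (x := -ρ) (by rwa [abs_neg, habs]) (by rwa [abs_neg, habs])
    rw [neg_sq] at h2
    linarith
  · by_contra! hlt
    have h1 := hmono (a := ρ) (b := x) (by simp; linarith) (by simp; linarith) hlt
    have h2 := h.le_V0 (x := ρ) (by rwa [habs]) (by rwa [habs])
    linarith

/-- The midpoint of the turning points is quadratically small. -/
lemma abs_midpoint_le (h : WellData a0 K0 D V0 V1 V2 V3 V4) {xm xp : ℝ} (hm : xm < 0)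
    (hp : 0 < xp) (hmD : |xm| ≤ D) (hpD : |xp| ≤ D) (heq : V0 xm = V0 xp) :
    a0 * |(xp + xm) / 2| ≤ 4 * K0 * ((xp - xm) / 2) ^ 2 := by
  have h1 := h.abs_V0_sub_le hmD
  have h2 := h.abs_V0_sub_le hpD
  have ha := h.le_V2_zero
  have hK := h.K0_nonneg ((abs_nonneg _).trans hmD)
  rw [abs_of_neg hm] at h1
  rw [abs_of_pos hp] at h2
  obtain ⟨y, rfl⟩ : ∃ y, xm = -y := ⟨-xm, by ring⟩
  have hy : 0 < y := by linarith
  rw [neg_neg] at h1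
  have h3 : |V2 0 * ((xp - y) / 2) * (xp + y)| ≤ K0 * (xp + y) ^ 3 := by
    have h4 : K0 * xp ^ 3 + K0 * y ^ 3 ≤ K0 * (xp + y) ^ 3 := by
      rw [← mul_add]
      gcongr
      have : 0 ≤ xp * y * (xp + y) := by positivity
      linarith
    rw [abs_le] at *
    constructor <;> linarith
  rw [abs_mul, abs_mul, abs_of_pos (by linarith : 0 < xp + y),
    abs_of_pos (by linarith [h.a0_pos] : 0 < V2 0)] at h3
  have h5 : V2 0 * |(xp - y) / 2| ≤ K0 * (xp + y) ^ 2 := by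
    apply le_of_mul_le_mul_right _ (by linarith : 0 < xp + y)
    linarith
  have h6 : a0 * |(xp - y) / 2| ≤ V2 0 * |(xp - y) / 2| := by gcongr
  have h7 : xp + -y = xp - y := by ring
  rw [h7]
  linarith

end WellData

namespace WellData

variable {a0 K0 D A : ℝ} {V0 V1 V2 V3 V4 : ℝ → ℝ}

lemma scale_bound (h : WellData a0 K0 D V0 V1 V2 V3 V4) (hD : 0 ≤ D) (hA : A * a0 = 4 * K0)
    {τ : ℝ} (hτ : τ * V2 0 = 2) : 4 ≤ A ∧ 0 < τ ∧ τ * K0 ≤ A / 2 := by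
  have ha := h.a0_pos
  have h1 := h.le_V2_zero
  have h2 := h.V2_zero_le hD
  have hA4 : 4 ≤ A := by
    apply le_of_mul_le_mul_right _ ha
    linarith
  have hτ0 : 0 < τ := pos_of_mul_pos_left (b := V2 0) (by rw [hτ]; norm_num) (by linarith)
  refine ⟨hA4, hτ0, ?_⟩
  have h3 : τ * a0 ≤ 2 := by rw [← hτ]; gcongr
  have h4 : τ * K0 = A * (τ * a0) / 4 := by linear_combination (-τ / 4) * hA
  have h5 : A * (τ * a0) ≤ A * 2 := by gcongr
  linarith

lemma third_deriv_bound (h : WellData a0 K0 D V0 V1 V2 V3 V4) (hA : A * a0 = 4 * K0)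
    {τ γ u M x z : ℝ} (hτ : τ * V2 0 = 2) (hγv : 18 * γ * V2 0 + V3 0 = 0) (hγ : |γ| ≤ A)
    (hu : u = 1 + 2 * γ * z) (hz : |z| ≤ M) (hx : |x| ≤ 2 * M) (hxD : |x| ≤ D)
    (hAM : A * M ≤ 1 / 100) :
    |τ * (48 * γ ^ 2 * u * V1 x + 18 * γ * u ^ 3 * V2 x + u ^ 5 * V3 x)| ≤ 110 * A ^ 3 * M := by
  have hD : 0 ≤ D := (abs_nonneg x).trans hxD
  have hM : 0 ≤ M := (abs_nonneg z).trans hz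
  have hK := h.K0_nonneg hD
  obtain ⟨hA4, hτ0, hτK⟩ := h.scale_bound hD hA hτ
  have hu1 : |u - 1| ≤ 2 * (A * M) := by
    rw [hu, add_sub_cancel_left, abs_mul, abs_mul, abs_two, mul_assoc]
    gcongr
  have hu2 := abs_le.1 (hu1.trans (by linarith : _ ≤ (1 : ℝ) / 50))
  have hu0 : 0 < u := by linarith
  have hKx : K0 * |x| ≤ K0 * (2 * M) := by gcongr
  have hV1 := (h.abs_V1_le hxD).trans hKx
  have hV2 := (h.abs_V2_sub_le hxD).trans hKx
  have hV3 := (h.abs_V3_sub_le hxD).trans hKx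
  have hv3 := h.V3_bound 0 (by simpa using hD)
  have hu3 : u ^ 3 ≤ 2 := by
    calc u ^ 3 ≤ (51 / 50) ^ 3 := by gcongr; linarith
      _ ≤ 2 := by norm_num
  have hu5 : u ^ 5 ≤ 2 := by
    calc u ^ 5 ≤ (51 / 50) ^ 5 := by gcongr; linarith
      _ ≤ 2 := by norm_num
  have t1 : |48 * γ ^ 2 * u * V1 x| ≤ 48 * A ^ 2 * 2 * (K0 * (2 * M)) := by
    rw [abs_mul, abs_mul, abs_mul, abs_pow, abs_of_pos hu0, abs_of_pos (by norm_num : (0:ℝ) < 48)]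
    gcongr
    linarith
  have t2 : |18 * γ * u ^ 3 * (V2 x - V2 0)| ≤ 18 * A * 2 * (K0 * (2 * M)) := by
    rw [abs_mul, abs_mul, abs_mul, abs_of_pos (pow_pos hu0 3),
      abs_of_pos (by norm_num : (0:ℝ) < 18)]
    gcongr
  have t3 : |u ^ 5 * (V3 x - V3 0)| ≤ 2 * (K0 * (2 * M)) := by
    rw [abs_mul, abs_of_pos (pow_pos hu0 5)]
    gcongr
  have t4 : |u ^ 3 * (u + 1) * (u - 1) * V3 0| ≤ 2 * 3 * (2 * (A * M)) * K0 := by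
    rw [abs_mul, abs_mul, abs_of_pos (by positivity : 0 < u ^ 3 * (u + 1))]
    gcongr
    linarith
  have hsum : 48 * γ ^ 2 * u * V1 x + 18 * γ * u ^ 3 * V2 x + u ^ 5 * V3 x =
      48 * γ ^ 2 * u * V1 x + 18 * γ * u ^ 3 * (V2 x - V2 0) + u ^ 5 * (V3 x - V3 0) +
        u ^ 3 * (u + 1) * (u - 1) * V3 0 := by
    linear_combination u ^ 3 * hγv
  have hKM : 0 ≤ K0 * M := by positivity
  have hA1 : 4 * A * (K0 * M) ≤ A ^ 2 * (K0 * M) := by gcongr; nlinarith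
  have hA2 : 4 * (K0 * M) ≤ A * (K0 * M) := by gcongr
  have hmain : |48 * γ ^ 2 * u * V1 x + 18 * γ * u ^ 3 * V2 x + u ^ 5 * V3 x| ≤
      200 * A ^ 2 * M * K0 + 20 * A ^ 2 * M * K0 := by
    rw [hsum]
    have hA0 : 0 ≤ A ^ 2 * (K0 * M) := by positivity
    rw [abs_le] at *
    constructor <;> linarith
  rw [abs_mul, abs_of_pos hτ0]
  calc τ * |48 * γ ^ 2 * u * V1 x + 18 * γ * u ^ 3 * V2 x + u ^ 5 * V3 x|
      ≤ τ * (200 * A ^ 2 * M * K0 + 20 * A ^ 2 * M * K0) := by gcongr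
    _ = 220 * A ^ 2 * M * (τ * K0) := by ring
    _ ≤ 220 * A ^ 2 * M * (A / 2) := by gcongr
    _ = _ := by ring

lemma second_deriv_zero_bound (h : WellData a0 K0 D V0 V1 V2 V3 V4) (hA : A * a0 = 4 * K0)
    {τ γ lam e x : ℝ} (hτ : τ * V2 0 = 2) (hγ : |γ| ≤ A)
    (hx : |x| ≤ 2 * A * e ^ 2) (hxe : |x| ≤ 2 * e)
    (hxD : |x| ≤ D) (hlam0 : 0 ≤ lam) (hlam : lam ≤ 4 * K0 * e ^ 2) :
    |τ * (8 * γ ^ 2 * (V0 x - lam) + 10 * γ * V1 x + V2 x) - 2| ≤ 50 * A ^ 3 * e ^ 2 := by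
  have hD : 0 ≤ D := (abs_nonneg x).trans hxD
  have hK := h.K0_nonneg hD
  obtain ⟨hA4, hτ0, hτK⟩ := h.scale_bound hD hA hτ
  have hKx : K0 * |x| ≤ K0 * (2 * A * e ^ 2) := by gcongr
  have hV1 := (h.abs_V1_le hxD).trans hKx
  have hV2 := (h.abs_V2_sub_le hxD).trans hKx
  have hV0 : |V0 x - lam| ≤ 8 * K0 * e ^ 2 := by
    have h1 : |V0 x| ≤ K0 * (2 * e) ^ 2 := (h.abs_V0_le hxD).trans (by gcongr)
    rw [abs_le] at *
    constructor <;> linarith [mul_nonneg hK (sq_nonneg e)]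
  have t1 : |8 * γ ^ 2 * (V0 x - lam)| ≤ 8 * A ^ 2 * (8 * K0 * e ^ 2) := by
    rw [abs_mul, abs_mul, abs_pow, abs_of_pos (by norm_num : (0:ℝ) < 8)]
    gcongr
  have t2 : |10 * γ * V1 x| ≤ 10 * A * (K0 * (2 * A * e ^ 2)) := by
    rw [abs_mul, abs_mul, abs_of_pos (by norm_num : (0:ℝ) < 10)]
    gcongr
  have hKe : 0 ≤ K0 * e ^ 2 := by positivity
  have hA1 : 4 * A * (K0 * e ^ 2) ≤ A ^ 2 * (K0 * e ^ 2) := by gcongr; nlinarith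
  have hmain : |8 * γ ^ 2 * (V0 x - lam) + 10 * γ * V1 x + (V2 x - V2 0)| ≤
      100 * A ^ 2 * e ^ 2 * K0 := by
    have hA0 : 0 ≤ A ^ 2 * (K0 * e ^ 2) := by positivity
    rw [abs_le] at *
    constructor <;> linarith
  have heq : τ * (8 * γ ^ 2 * (V0 x - lam) + 10 * γ * V1 x + V2 x) - 2 =
      τ * (8 * γ ^ 2 * (V0 x - lam) + 10 * γ * V1 x + (V2 x - V2 0)) := by
    linear_combination hτ
  rw [heq, abs_mul, abs_of_pos hτ0]
  calc τ * |8 * γ ^ 2 * (V0 x - lam) + 10 * γ * V1 x + (V2 x - V2 0)|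
      ≤ τ * (100 * A ^ 2 * e ^ 2 * K0) := by gcongr
    _ = 100 * A ^ 2 * e ^ 2 * (τ * K0) := by ring
    _ ≤ 100 * A ^ 2 * e ^ 2 * (A / 2) := by gcongr
    _ = _ := by ring

end WellData

/-- Integrating a bound on the third derivative of a perturbation of `z² - e²`. -/
lemma taylor_bounds {e r B : ℝ} {F F1 F2 F3 : ℝ → ℝ} (he : 0 < e) (her : e < r) (hB : 0 ≤ B)
    (hF : ∀ z ∈ Ioo (-r) r, HasDerivAt F (F1 z) z)
    (hF1 : ∀ z ∈ Ioo (-r) r, HasDerivAt F1 (F2 z) z)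
    (hF2 : ∀ z ∈ Ioo (-r) r, HasDerivAt F2 (F3 z) z)
    (hR : F e = 0) (hL : F (-e) = 0) (h2 : |F2 0 - 2| ≤ B * e ^ 2)
    (h3 : ∀ z ∈ Ioo (-r) r, |F3 z| ≤ B * (|z| + e)) :
    (∀ z ∈ Ioo (-r) r, |F1 z - 2 * z| ≤ 4 * B * (|z| + e) ^ 3) ∧
      ∀ z ∈ Ioo (-r) r, |F2 z - 2| ≤ B * (|z| + e) ^ 2 := by
  have h0 : (0 : ℝ) ∈ Ioo (-r) r := ⟨by linarith, by linarith⟩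
  have hsub : ∀ x ∈ Ioo (-r) r, ∀ y ∈ Ioo (-r) r, uIcc x y ⊆ Ioo (-r) r := fun x hx y hy =>
    ordConnected_Ioo.uIcc_subset hx hy
  have hsecond : ∀ z ∈ Ioo (-r) r, |F2 z - 2| ≤ B * (|z| + e) ^ 2 := by
    intro z hz
    have h4 := abs_sub_le_of_hasDerivAt (f := F2) (f' := F3) (a := 0) (b := z)
      (B := B * (|z| + e)) (fun t ht => hF2 t (hsub 0 h0 z hz ht)) (fun t ht => by
        have : |t| ≤ |z| := by simpa using abs_sub_left_of_mem_uIcc ht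
        refine (h3 t (hsub 0 h0 z hz ht)).trans ?_
        gcongr)
    rw [sub_zero] at h4
    have h5 : 0 ≤ B * (|z| * e) := by positivity
    have h6 : F2 z - 2 = (F2 z - F2 0) + (F2 0 - 2) := by ring
    rw [h6]
    refine (abs_add_le _ _).trans ?_
    linarith
  refine ⟨fun z hz => ?_, hsecond⟩
  have hin : ∀ t ∈ Icc (-e) e, t ∈ Ioo (-r) r := fun t ht =>
    ⟨by linarith [ht.1], by linarith [ht.2]⟩
  obtain ⟨ξ, hξ, hξ0⟩ := exists_hasDerivAt_eq_zero (f := fun z => F z - z ^ 2)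
    (f' := fun z => F1 z - 2 * z) (by linarith : -e < e)
    (fun t ht => ((hF t (hin t ht)).continuousAt.sub
      (continuousAt_id.pow 2)).continuousWithinAt) (by simp [hR, hL])
    (fun t ht => by
      have := (hF t (hin t ⟨ht.1.le, ht.2.le⟩)).sub (hasDerivAt_pow 2 t)
      exact this.congr_deriv (by push_cast; ring))
  have hξe : |ξ| ≤ e := abs_le.2 ⟨hξ.1.le, hξ.2.le⟩
  have hξr := hin ξ ⟨hξ.1.le, hξ.2.le⟩
  have hz0 := abs_nonneg z
  have h4 := abs_sub_le_of_hasDerivAt (f := fun z => F1 z - 2 * z) (f' := fun z => F2 z - 2)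
    (a := ξ) (b := z) (B := B * (2 * (|z| + e)) ^ 2)
    (fun t ht => by
      have := (hF1 t (hsub ξ hξr z hz ht)).sub ((hasDerivAt_id t).const_mul 2)
      exact this.congr_deriv (by simp))
    (fun t ht => by
      refine (hsecond t (hsub ξ hξr z hz ht)).trans ?_
      have h5 : |t| ≤ |z| + e := by
        have hz' := abs_le.1 (le_refl |z|)
        rw [abs_le]
        rcases mem_uIcc.1 ht with ⟨h6, h7⟩ | ⟨h6, h7⟩ <;>
          constructor <;> linarith [hξ.1, hξ.2]
      gcongr
      linarith)
  rw [hξ0, sub_zero] at h4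
  have h5 : |z - ξ| ≤ |z| + e := (abs_sub z ξ).trans (by linarith)
  calc |F1 z - 2 * z| ≤ B * (2 * (|z| + e)) ^ 2 * |z - ξ| := h4
    _ ≤ B * (2 * (|z| + e)) ^ 2 * (|z| + e) := by gcongr
    _ = _ := by ring

namespace WellData

variable {a0 K0 D A : ℝ} {V0 V1 V2 V3 V4 : ℝ → ℝ}

lemma turning_bounds (h : WellData a0 K0 D V0 V1 V2 V3 V4) {r lam xm xp : ℝ}
    (hA : A * a0 = 4 * K0) (hr : 0 < r) (hrD : 4 * r ≤ D) (hAr : 10 ^ 6 * (A ^ 2 * r) ≤ 1)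
    (hlam : lam ≤ a0 / 4 * (r / 2) ^ 2) (hm : xm < 0) (hp : 0 < xp)
    (hVm : V0 xm = lam) (hVp : V0 xp = lam) :
    4 ≤ A ∧ 10 ^ 5 * (A * r) ≤ 1 ∧ (xp - xm) / 2 ≤ r / 2 ∧
      |(xp + xm) / 2| ≤ A * ((xp - xm) / 2) ^ 2 ∧ lam ≤ 4 * K0 * ((xp - xm) / 2) ^ 2 := by
  have hD : 0 ≤ D := by linarith
  have ha := h.a0_pos
  have hK := h.K0_nonneg hD
  have hV2 : 0 < V2 0 := ha.trans_le h.le_V2_zero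
  obtain ⟨hA4, -, -⟩ := h.scale_bound hD hA (τ := 2 / V2 0) (by field_simp)
  have hAr' : 10 ^ 5 * (A * r) ≤ 1 := by
    have : 4 * A * r ≤ A ^ 2 * r := by gcongr; nlinarith
    have : 0 ≤ A * r := by positivity
    linarith
  have hKr : K0 * (r / 2) ≤ a0 / 4 := by
    have : A * r * a0 ≤ 1 * a0 := by
      gcongr
      have : 0 ≤ A * r := by positivity
      linarith
    linarith [congrArg (fun t => t * r) hA]
  have hxm := h.abs_lt_of_V0_eq (by linarith) (by linarith) hKr hlam hVm
  have hxp := h.abs_lt_of_V0_eq (by linarith) (by linarith) hKr hlam hVp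
  have hc := h.abs_midpoint_le hm hp (hxm.trans (by linarith)) (hxp.trans (by linarith))
    (hVm.trans hVp.symm)
  refine ⟨hA4, hAr', ?_, ?_, ?_⟩
  · rw [abs_le] at hxm hxp
    linarith [hxm.1, hxp.2]
  · apply le_of_mul_le_mul_left _ ha
    rw [← hA] at hc
    linarith
  · have h1 := (le_abs_self _).trans (h.abs_V0_le (hxp.trans (by linarith : r / 2 ≤ D)))
    rw [hVp, abs_of_pos hp] at h1
    have h2 : K0 * xp ^ 2 ≤ K0 * (2 * ((xp - xm) / 2)) ^ 2 := by
      gcongr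
      linarith
    linarith

lemma abs_gamma_le (h : WellData a0 K0 D V0 V1 V2 V3 V4) (hD : 0 ≤ D)
    (hA : A * a0 = 4 * K0) {γ : ℝ} (hγv : 18 * γ * V2 0 + V3 0 = 0) : |γ| ≤ A / 72 := by
  have ha := h.a0_pos
  have h1 := h.V3_bound 0 (by simpa using hD)
  have h2 : V3 0 = -(18 * γ * V2 0) := by linarith
  rw [h2, abs_neg, abs_mul, abs_mul, abs_of_pos (ha.trans_le h.le_V2_zero),
    abs_of_pos (by norm_num : (0:ℝ) < 18)] at h1
  have h3 : |γ| * a0 ≤ |γ| * V2 0 := by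
    gcongr
    exact h.le_V2_zero
  apply le_of_mul_le_mul_right _ ha
  linarith

/-- After the quadratic change of variables the Langer equation takes its normalised form. -/
lemma normalizedLanger (h : WellData a0 K0 D V0 V1 V2 V3 V4) {r lam xm xp b τ γ k c e : ℝ}
    {g : ℝ → ℝ} (hg : IsLanger (fun x => V0 x - lam) xm xp b g)
    (hA : A * a0 = 4 * K0) (hr : 0 < r) (hrD : 4 * r ≤ D) (hAr : 10 ^ 6 * (A ^ 2 * r) ≤ 1)
    (hlam0 : 0 < lam) (hlam : lam ≤ a0 / 4 * (r / 2) ^ 2) (hm : xm < 0) (hp : 0 < xp)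
    (hVm : V0 xm = lam) (hVp : V0 xp = lam) (he : e = (xp - xm) / 2) (hc : c = (xp + xm) / 2)
    (hτ : τ * V2 0 = 2) (hγv : 18 * γ * V2 0 + V3 0 = 0) (hk : 0 < k) (hk4 : 4 * k ^ 4 = τ) :
    NormalizedLanger e (2 * k * √(-b)) r (440 * A ^ 3)
      (fun z => k * g (c + z + γ * (z ^ 2 - e ^ 2)))
      (fun z => k * (deriv g (c + z + γ * (z ^ 2 - e ^ 2)) * (1 + 2 * γ * z)))
      (fun z => τ * ((1 + 2 * γ * z) ^ 2 * (V0 (c + z + γ * (z ^ 2 - e ^ 2)) - lam)))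
      (fun z => τ * (4 * γ * (1 + 2 * γ * z) * (V0 (c + z + γ * (z ^ 2 - e ^ 2)) - lam) +
        (1 + 2 * γ * z) ^ 3 * V1 (c + z + γ * (z ^ 2 - e ^ 2))))
      (fun z => τ * (8 * γ ^ 2 * (V0 (c + z + γ * (z ^ 2 - e ^ 2)) - lam) +
        10 * γ * (1 + 2 * γ * z) ^ 2 * V1 (c + z + γ * (z ^ 2 - e ^ 2)) +
        (1 + 2 * γ * z) ^ 4 * V2 (c + z + γ * (z ^ 2 - e ^ 2))))
      (fun z => τ * (48 * γ ^ 2 * (1 + 2 * γ * z) * V1 (c + z + γ * (z ^ 2 - e ^ 2)) +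
        18 * γ * (1 + 2 * γ * z) ^ 3 * V2 (c + z + γ * (z ^ 2 - e ^ 2)) +
        (1 + 2 * γ * z) ^ 5 * V3 (c + z + γ * (z ^ 2 - e ^ 2)))) := by
  obtain ⟨hgc, hgm, hgp, hgm', hgd⟩ := hg
  have hD : 0 ≤ D := by linarith
  obtain ⟨hA4, hAr', her, hcA, hlamK⟩ := h.turning_bounds hA hr hrD hAr hlam hm hp hVm hVp
  rw [← he] at her hlamK hcA
  rw [← hc] at hcA
  have he0 : 0 < e := by linarith
  have hγ72 := h.abs_gamma_le hD hA hγv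
  have hγA : |γ| ≤ A := by linarith
  have hb : b < 0 := by
    by_contra! hb
    have h1 : √(-b) = 0 := Real.sqrt_eq_zero_of_nonpos (by linarith)
    have h2 := hgm (by linarith : xm < xp)
    rw [hgp, hgm', h1] at h2
    linarith
  have hsq : √(-b) ^ 2 = -b := Real.sq_sqrt (by linarith)
  have hsmall : ∀ t, |t| ≤ r → |γ * t| ≤ 1 / 100 := fun t ht => by
    rw [abs_mul]
    calc |γ| * |t| ≤ A * r := by gcongr
      _ ≤ 1 / 100 := by linarith
  have hu : ∀ z ∈ Ioo (-r) r, 0 < 1 + 2 * γ * z := fun z hz => by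
    linarith [(abs_le.1 (hsmall z (abs_le.2 ⟨hz.1.le, hz.2.le⟩))).1]
  have hχe : c + e + γ * (e ^ 2 - e ^ 2) = xp := by rw [hc, he]; ring
  have hχe' : c + -e + γ * ((-e) ^ 2 - e ^ 2) = xm := by rw [hc, he]; ring
  have hsum : ∀ z ∈ Ioo (-r) r, ∀ y ∈ Ioo (-r) r, 0 < 1 + γ * (z + y) := fun z hz y hy => by
    linarith [hu z hz, hu y hy]
  have heI : e ∈ Ioo (-r) r := ⟨by linarith, by linarith⟩
  have heI' : -e ∈ Ioo (-r) r := ⟨by linarith, by linarith⟩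
  have hχmono : StrictMonoOn (fun z => c + z + γ * (z ^ 2 - e ^ 2)) (Ioo (-r) r) := by
    intro z hz y hy hzy
    have h1 := mul_pos (sub_pos.2 hzy) (hsum z hz y hy)
    simp only
    linarith
  have hχ : ∀ z, HasDerivAt (fun z => c + z + γ * (z ^ 2 - e ^ 2)) (1 + 2 * γ * z) z := fun z => by
    have := ((hasDerivAt_id z).const_add c).add
      (((hasDerivAt_pow 2 z).sub_const (e ^ 2)).const_mul γ)
    exact this.congr_deriv (by push_cast; ring)
  have hud : ∀ z, HasDerivAt (fun z => 1 + 2 * γ * z) (2 * γ) z := fun z => by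
    simpa using ((hasDerivAt_id z).const_mul (2 * γ)).const_add 1
  have hupow : ∀ (n : ℕ) z, HasDerivAt (fun z => (1 + 2 * γ * z) ^ n)
    (n * (1 + 2 * γ * z) ^ (n - 1) * (2 * γ)) z := fun n z => (hud z).pow n
  have hV0c := fun z => (h.V0_deriv _).comp z (hχ z)
  have hV1c := fun z => (h.V1_deriv _).comp z (hχ z)
  have hV2c := fun z => (h.V2_deriv _).comp z (hχ z)
  have hne : ∀ z ∈ Ioo (-r) r, z ≠ e → z ≠ -e →
      c + z + γ * (z ^ 2 - e ^ 2) ≠ xm ∧ c + z + γ * (z ^ 2 - e ^ 2) ≠ xp :=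
    fun z hz h1 h2 => ⟨fun h3 => h2 (hχmono.injOn hz heI' (h3.trans hχe'.symm)),
      fun h3 => h1 (hχmono.injOn hz heI (h3.trans hχe.symm))⟩
  have hχabs : ∀ z ∈ Ioo (-r) r, |c + z + γ * (z ^ 2 - e ^ 2)| ≤ 2 * (|z| + e) := by
    intro z hz
    have hz' : |z| ≤ r := abs_le.2 ⟨hz.1.le, hz.2.le⟩
    have h1 := hsmall z hz'
    have h2 := hsmall e (by rw [abs_of_pos he0]; linarith)
    have h3 : c + z + γ * (z ^ 2 - e ^ 2) = c + z + ((γ * z) * z - (γ * e) * e) := by ring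
    have h4 : |c| ≤ 1 / 100 * e := by
      refine hcA.trans ?_
      have : A * e ≤ A * r := by gcongr; linarith
      rw [pow_two, ← mul_assoc]
      gcongr
      linarith
    have h5 : |γ * z * z| ≤ 1 / 100 * |z| := by rw [abs_mul]; gcongr
    have h6 : |γ * e * e| ≤ 1 / 100 * e := by rw [abs_mul, abs_of_pos he0]; gcongr
    rw [h3]
    have h7 := abs_add_le (c + z) ((γ * z) * z - (γ * e) * e)
    have h8 := abs_add_le c z
    have h9 := abs_sub ((γ * z) * z) ((γ * e) * e)
    linarith [abs_nonneg z]
  have hF0d : ∀ z ∈ Ioo (-r) r, HasDerivAt _ _ z := fun z _ =>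
    (((hupow 2 z).mul ((hV0c z).sub_const lam)).const_mul τ)
  have hF1d : ∀ z ∈ Ioo (-r) r, HasDerivAt _ _ z := fun z _ =>
    (((((hud z).const_mul (4 * γ)).mul ((hV0c z).sub_const lam)).add
      ((hupow 3 z).mul (hV1c z))).const_mul τ)
  have hF2d : ∀ z ∈ Ioo (-r) r, HasDerivAt _ _ z := fun z _ =>
    ((((((hV0c z).sub_const lam).const_mul (8 * γ ^ 2)).add
      (((hupow 2 z).const_mul (10 * γ)).mul (hV1c z))).add
      ((hupow 4 z).mul (hV2c z))).const_mul τ)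
  have hF0 : ∀ z ∈ Ioo (-r) r, HasDerivAt
      (fun z => τ * ((1 + 2 * γ * z) ^ 2 * (V0 (c + z + γ * (z ^ 2 - e ^ 2)) - lam)))
      (τ * (4 * γ * (1 + 2 * γ * z) * (V0 (c + z + γ * (z ^ 2 - e ^ 2)) - lam) +
        (1 + 2 * γ * z) ^ 3 * V1 (c + z + γ * (z ^ 2 - e ^ 2)))) z := fun z hz =>
    (hF0d z hz).congr_deriv (by simp only [Function.comp_apply]; push_cast; ring)
  have hF1 : ∀ z ∈ Ioo (-r) r, HasDerivAt
      (fun z => τ * (4 * γ * (1 + 2 * γ * z) * (V0 (c + z + γ * (z ^ 2 - e ^ 2)) - lam) +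
        (1 + 2 * γ * z) ^ 3 * V1 (c + z + γ * (z ^ 2 - e ^ 2))))
      (τ * (8 * γ ^ 2 * (V0 (c + z + γ * (z ^ 2 - e ^ 2)) - lam) +
        10 * γ * (1 + 2 * γ * z) ^ 2 * V1 (c + z + γ * (z ^ 2 - e ^ 2)) +
        (1 + 2 * γ * z) ^ 4 * V2 (c + z + γ * (z ^ 2 - e ^ 2)))) z := fun z hz =>
    (hF1d z hz).congr_deriv (by simp only [Function.comp_apply]; push_cast; ring)
  have hF2 : ∀ z ∈ Ioo (-r) r, HasDerivAt
      (fun z => τ * (8 * γ ^ 2 * (V0 (c + z + γ * (z ^ 2 - e ^ 2)) - lam) +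
        10 * γ * (1 + 2 * γ * z) ^ 2 * V1 (c + z + γ * (z ^ 2 - e ^ 2)) +
        (1 + 2 * γ * z) ^ 4 * V2 (c + z + γ * (z ^ 2 - e ^ 2))))
      (τ * (48 * γ ^ 2 * (1 + 2 * γ * z) * V1 (c + z + γ * (z ^ 2 - e ^ 2)) +
        18 * γ * (1 + 2 * γ * z) ^ 3 * V2 (c + z + γ * (z ^ 2 - e ^ 2)) +
        (1 + 2 * γ * z) ^ 5 * V3 (c + z + γ * (z ^ 2 - e ^ 2)))) z := fun z hz =>
    (hF2d z hz).congr_deriv (by simp only [Function.comp_apply]; push_cast; ring)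
  have hFe : τ * ((1 + 2 * γ * e) ^ 2 * (V0 (c + e + γ * (e ^ 2 - e ^ 2)) - lam)) = 0 := by
    rw [hχe, hVp]; ring
  have hFe' : τ * ((1 + 2 * γ * -e) ^ 2 *
      (V0 (c + -e + γ * ((-e) ^ 2 - e ^ 2)) - lam)) = 0 := by
    rw [hχe', hVm]; ring
  have h3 : ∀ z ∈ Ioo (-r) r,
      |τ * (48 * γ ^ 2 * (1 + 2 * γ * z) * V1 (c + z + γ * (z ^ 2 - e ^ 2)) +
        18 * γ * (1 + 2 * γ * z) ^ 3 * V2 (c + z + γ * (z ^ 2 - e ^ 2)) +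
        (1 + 2 * γ * z) ^ 5 * V3 (c + z + γ * (z ^ 2 - e ^ 2)))| ≤
      110 * A ^ 3 * (|z| + e) := fun z hz => by
    have hz' : |z| ≤ r := abs_le.2 ⟨hz.1.le, hz.2.le⟩
    have hM : |z| + e ≤ 2 * r := by linarith
    have hAM : A * (|z| + e) ≤ A * (2 * r) := by gcongr
    exact h.third_deriv_bound hA hτ hγv hγA rfl (by linarith) (hχabs z hz)
      ((hχabs z hz).trans (by linarith)) (by linarith)
  have h0 : (0 : ℝ) ∈ Ioo (-r) r := ⟨by linarith, by linarith⟩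
  have hχ0 : |c + 0 + γ * (0 ^ 2 - e ^ 2)| ≤ 2 * A * e ^ 2 := by
    have h1 : c + 0 + γ * (0 ^ 2 - e ^ 2) = c - γ * e ^ 2 := by ring
    have h2 : |γ * e ^ 2| ≤ A * e ^ 2 := by
      rw [abs_mul, abs_of_nonneg (sq_nonneg e)]
      gcongr
    rw [h1]
    refine (abs_sub _ _).trans ?_
    linarith
  have hχle := hχabs 0 h0
  rw [abs_zero, zero_add] at hχle
  have h2 := h.second_deriv_zero_bound hA hτ hγA hχ0 hχle (hχle.trans (by linarith)) hlam0.le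
    hlamK
  have hT := taylor_bounds (B := 110 * A ^ 3) he0 heI.2 (by positivity) hF0 hF1 hF2 hFe hFe'
    (by
      have h5 : 50 * A ^ 3 * e ^ 2 ≤ 110 * A ^ 3 * e ^ 2 := by gcongr; norm_num
      simp only [mul_zero, add_zero, one_pow, mul_one, one_mul] at h2 ⊢
      exact h2.trans h5) h3
  refine
    { e_pos := he0
      e_lt := heI.2
      K_nonneg := by positivity
      small := ?_
      w_cont := by fun_prop
      w_mono := fun x hx y hy hxy => mul_lt_mul_of_pos_left (hgm (hχmono hx hy hxy)) hk
      w_right := ?_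
      w_left := ?_
      w_deriv := fun z hz h1 h2 => ?_
      v_pos := fun z hz h1 h2 => ?_
      eqn := fun z hz h1 h2 => ?_
      F_deriv := hF0
      F1_deriv := hF1
      F2_deriv := hF2
      F_right := hFe
      F_left := hFe'
      F1_bound := fun z hz => (hT.1 z hz).trans (le_of_eq (by ring))
      F2_bound := fun z hz => (hT.2 z hz).trans ?_
      F3_bound := fun z hz => (h3 z hz).trans ?_ }
  · have h5 : (10 ^ 6 * (A ^ 2 * r)) ^ 2 ≤ 1 := pow_le_one₀ (by positivity) hAr
    have h6 : 4 * (A ^ 3 * r ^ 2) ≤ A * (A ^ 3 * r ^ 2) := by gcongr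
    linarith [show 0 ≤ A ^ 3 * r ^ 2 by positivity]
  · simp only [hχe, hgp]
    ring
  · simp only [hχe', hgm']
    ring
  · obtain ⟨h5, h6⟩ := hne z hz h1 h2
    exact ((hgd _ h5 h6).1.hasDerivAt.comp z (hχ z)).const_mul k
  · obtain ⟨h5, h6⟩ := hne z hz h1 h2
    exact mul_pos hk (mul_pos (hgd _ h5 h6).2.1 (hu z hz))
  · obtain ⟨h5, h6⟩ := hne z hz h1 h2
    have h7 := (hgd _ h5 h6).2.2
    simp only at h7 ⊢
    rw [← h7, ← hk4]
    linear_combination (-4 * k ^ 4 * deriv g (c + z + γ * (z ^ 2 - e ^ 2)) ^ 2 *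
      (1 + 2 * γ * z) ^ 2) * hsq
  · gcongr
    linarith
  · gcongr
    linarith

end WellData

/-- The inner bound on the third derivative of a Langer transformation, with a constant depending
only on the bounds for the well. -/
theorem WellData.abs_iteratedDeriv_three_langer_le {a0 K0 D A : ℝ} {V0 V1 V2 V3 V4 : ℝ → ℝ}
    (h : WellData a0 K0 D V0 V1 V2 V3 V4) {r lam xm xp b : ℝ} {g : ℝ → ℝ}
    (hg : IsLanger (fun x => V0 x - lam) xm xp b g)
    (hA : A * a0 = 4 * K0) (hr : 0 < r) (hrD : 4 * r ≤ D) (hAr : 10 ^ 6 * (A ^ 2 * r) ≤ 1)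
    (hlam0 : 0 < lam) (hlam : lam ≤ a0 / 4 * (r / 2) ^ 2) (hm : xm < 0) (hp : 0 < xp)
    (hVm : V0 xm = lam) (hVp : V0 xp = lam) {x : ℝ} (hxm : xm / 2 < x) (hxr : x < r / 2) :
    |iteratedDeriv 3 g x| ≤ 6 * (600000 * (440 * A ^ 3) +
      144000 * A * (440 * A ^ 3 * r) + 24 * A ^ 2) / √(√(1 / (2 * K0))) := by
  have hD : 0 ≤ D := by linarith
  have hV2 : 0 < V2 0 := h.a0_pos.trans_le h.le_V2_zero
  have hV2K := h.V2_zero_le hD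
  obtain ⟨hA4, hAr', her, hcA, -⟩ := h.turning_bounds hA hr hrD hAr hlam hm hp hVm hVp
  obtain ⟨e, he⟩ : ∃ e, e = (xp - xm) / 2 := ⟨_, rfl⟩
  obtain ⟨c, hc⟩ : ∃ c, c = (xp + xm) / 2 := ⟨_, rfl⟩
  obtain ⟨γ, hγ⟩ : ∃ γ, γ = -V3 0 / (18 * V2 0) := ⟨_, rfl⟩
  rw [← he] at her hcA
  rw [← hc] at hcA
  have he0 : 0 < e := by linarith
  have hγv : 18 * γ * V2 0 + V3 0 = 0 := by
    rw [hγ]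
    field_simp
    ring
  have hγ72 := h.abs_gamma_le hD hA hγv
  have hγA : |γ| ≤ A := by linarith
  have hγr : |γ| * r ≤ 1 / 100 := by
    have : |γ| * r ≤ A * r := by gcongr
    linarith
  have hk0 : 0 < √(√(1 / (2 * K0))) :=
    Real.sqrt_pos.2 (Real.sqrt_pos.2 (div_pos one_pos (by linarith)))
  have hkk : √(√(1 / (2 * K0))) ≤ √(√(1 / (2 * V2 0))) := by gcongr
  have hk : 0 < √(√(1 / (2 * V2 0))) := hk0.trans_le hkk
  have hk4 : 4 * √(√(1 / (2 * V2 0))) ^ 4 = 2 / V2 0 := by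
    rw [show (4 : ℕ) = 2 * 2 from rfl, pow_mul, Real.sq_sqrt (Real.sqrt_nonneg _),
      Real.sq_sqrt (by positivity)]
    field_simp
    norm_num
  have hN := h.normalizedLanger hg hA hr hrD hAr hlam0 hlam hm hp hVm hVp he hc
    (by field_simp) hγv hk hk4
  have hc' : |c| ≤ 1 / 100 * e := by
    refine hcA.trans ?_
    have : A * e ≤ A * r := by gcongr; linarith
    rw [pow_two, ← mul_assoc]
    gcongr
    linarith
  have hγe : |γ * e ^ 2| ≤ 1 / 100 * e := by
    have : |γ| * e ≤ |γ| * r := by gcongr; linarith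
    rw [abs_mul, abs_of_nonneg (sq_nonneg e), pow_two, ← mul_assoc]
    gcongr
    linarith
  have hγr2 : |γ * r ^ 2| ≤ 1 / 100 * r := by
    rw [abs_mul, abs_of_nonneg (sq_nonneg r), pow_two, ← mul_assoc]
    gcongr
  rw [abs_le] at hc' hγe hγr2
  refine (hN.abs_iteratedDeriv_three_le hk (by linarith) (fun z => rfl)
    ⟨by linarith, by linarith⟩).trans ?_
  rw [← sq_abs γ]
  gcongr

lemma SingleWell.wellData {V : ℝ → ℝ → ℝ} {lammax δ pp pm Vp Vm : ℝ}
    (hV : SingleWell V lammax δ pp pm Vp Vm) {a0 K0 D lam : ℝ} (ha0 : 0 < a0)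
    (hlam : lam ∈ Icc 0 lammax) (ha : a0 ≤ iteratedDeriv 2 (fun x => V x lam) 0)
    (hK : ∀ n ≤ 4, ∀ x, |x| ≤ D → |iteratedDeriv n (fun x => V x lam) x| ≤ K0) :
    WellData a0 K0 D (fun x => V x lam) (iteratedDeriv 1 fun x => V x lam)
      (iteratedDeriv 2 fun x => V x lam) (iteratedDeriv 3 fun x => V x lam)
      (iteratedDeriv 4 fun x => V x lam) := by
  have hd : ∀ n : ℕ, (n : WithTop ℕ∞) < 5 → ∀ x, HasDerivAt (iteratedDeriv n fun x => V x lam)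
      (iteratedDeriv (n + 1) (fun x => V x lam) x) x := fun n hn x => by
    rw [iteratedDeriv_succ]
    exact ((hV.smooth lam hlam).differentiable_iteratedDeriv n hn x).hasDerivAt
  exact
    { a0_pos := ha0
      V0_deriv := fun x => by simpa using hd 0 (by norm_num) x
      V1_deriv := hd 1 (by norm_num)
      V2_deriv := hd 2 (by norm_num)
      V3_deriv := hd 3 (by norm_num)
      V2_bound := hK 2 (by norm_num)
      V3_bound := hK 3 (by norm_num)
      V4_bound := hK 4 (by norm_num)
      V0_zero := hV.V_zero lam hlam
      V1_zero := by simpa using hV.dV_zero lam hlam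
      le_V2_zero := ha
      V1_pos := fun x hx => by simpa using hV.dV_pos lam hlam x hx
      V1_neg := fun x hx => by simpa using hV.dV_neg lam hlam x hx }

/-- Uniform bounds for the derivatives of a single-well potential near its minimum. -/
lemma SingleWell.exists_bounds {V : ℝ → ℝ → ℝ} {lammax δ pp pm Vp Vm : ℝ}
    (hV : SingleWell V lammax δ pp pm Vp Vm) :
    ∃ a0 > 0, ∃ K0, ∀ lam ∈ Icc 0 lammax, a0 ≤ iteratedDeriv 2 (fun x => V x lam) 0 ∧
      ∀ n ≤ 4, ∀ x, |x| ≤ δ / 2 → |iteratedDeriv n (fun x => V x lam) x| ≤ K0 := by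
  have hδ := hV.delta_pos
  have hcont : ∀ n ≤ 5, ContinuousOn
      (fun p : ℝ × ℝ => iteratedDeriv n (fun x => V x p.2) p.1)
      (Ioo (-δ) δ ×ˢ Icc (0:ℝ) lammax) := fun n hn => by
    simpa [pdermix] using hV.mixed_cont 0 (by norm_num) n hn
  obtain ⟨l0, hl0, hmin⟩ := isCompact_Icc.exists_isMinOn (nonempty_Icc.2 hV.lammax_pos.le)
    ((hcont 2 (by norm_num)).comp (f := fun l : ℝ => ((0 : ℝ), l)) (s := Icc 0 lammax)
      (by fun_prop) (fun l hl => ⟨⟨by linarith, hδ⟩, hl⟩))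
  have hK : ∀ n, ∃ K, n ≤ 4 → ∀ lam ∈ Icc 0 lammax, ∀ x, |x| ≤ δ / 2 →
      |iteratedDeriv n (fun x => V x lam) x| ≤ K := fun n => by
    by_cases hn : n ≤ 4
    · obtain ⟨K, hK⟩ := (isCompact_Icc.prod isCompact_Icc).exists_bound_of_continuousOn
        (s := Icc (-(δ / 2)) (δ / 2) ×ˢ Icc (0:ℝ) lammax)
        ((hcont n (by omega)).mono (prod_mono (Icc_subset_Ioo (by linarith) (by linarith))
          subset_rfl))
      exact ⟨K, fun _ lam hlam x hx => hK (x, lam) ⟨abs_le.1 hx, hlam⟩⟩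
    · exact ⟨0, fun h => absurd h hn⟩
  choose K hK using hK
  refine ⟨_, hV.d2V_pos l0 hl0, (Finset.range 5).sup' ⟨0, by simp⟩ K,
    fun lam hlam => ⟨hmin hlam, fun n hn x hx => (hK n hn lam hlam x hx).trans ?_⟩⟩
  exact Finset.le_sup' K (Finset.mem_range.2 (by omega))

/-- **Upper bound on |g'''(x;λ)| in the inner region.** -/
theorem langer_third_deriv_bound_inner (V : ℝ → ℝ → ℝ) (lammax δ pp pm Vp Vm : ℝ)
    (hV : SingleWell V lammax δ pp pm Vp Vm)
    (xm xp : ℝ → ℝ)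
    (hx : ∀ lam : ℝ, 0 < lam → lam ≤ lammax →
      xm lam < 0 ∧ 0 < xp lam ∧ V (xm lam) lam = lam ∧ V (xp lam) lam = lam)
    (g : ℝ → ℝ → ℝ)
    (hg : ∀ lam : ℝ, 0 < lam → lam ≤ lammax →
      IsLanger (fun x => V x lam - lam) (xm lam) (xp lam)
        (bParam (fun x => V x lam - lam) (xm lam) (xp lam)) (fun x => g x lam)) :
    ∃ δ0 > (0:ℝ), ∃ lam0 > (0:ℝ), lam0 ≤ lammax ∧ ∃ c > (0:ℝ),
      ∀ lam : ℝ, 0 < lam → lam ≤ lam0 →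
        ∀ x : ℝ, (xm lam) / 2 < x → x < δ0 →
          |iteratedDeriv 3 (fun x' => g x' lam) x| ≤ c := by
  obtain ⟨a0, ha0, K0, hb⟩ := hV.exists_bounds
  have hδ := hV.delta_pos
  have hwell := fun lam hlam => hV.wellData ha0 hlam (hb lam hlam).1 (hb lam hlam).2
  have hK0 : 0 < K0 := by
    have h0 := hwell 0 ⟨le_rfl, hV.lammax_pos.le⟩
    exact (ha0.trans_le h0.le_V2_zero).trans_le (h0.V2_zero_le (by linarith))
  obtain ⟨A, hA⟩ : ∃ A, A = 4 * K0 / a0 := ⟨_, rfl⟩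
  have hA0 : 0 < A := by rw [hA]; positivity
  have hAa : A * a0 = 4 * K0 := by rw [hA]; field_simp
  obtain ⟨r, hr⟩ : ∃ r, r = min (δ / 8) (1 / (10 ^ 6 * A ^ 2)) := ⟨_, rfl⟩
  have hr0 : 0 < r := by rw [hr]; positivity
  have hrD : 4 * r ≤ δ / 2 := by linarith [hr.trans_le (min_le_left _ _)]
  have hrA : 10 ^ 6 * (A ^ 2 * r) ≤ 1 := by
    have h1 := hr.trans_le (min_le_right _ _)
    rw [le_div_iff₀ (by positivity)] at h1
    linarith
  refine ⟨r / 2, by positivity, min lammax (a0 / 4 * (r / 2) ^ 2),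
    lt_min hV.lammax_pos (by positivity), min_le_left _ _,
    6 * (600000 * (440 * A ^ 3) + 144000 * A * (440 * A ^ 3 * r) + 24 * A ^ 2) /
      √(√(1 / (2 * K0))), by positivity, fun lam hlam0 hlam x hxm hxr => ?_⟩
  have hlam' : lam ≤ lammax := hlam.trans (min_le_left _ _)
  obtain ⟨hm, hp, hVm, hVp⟩ := hx lam hlam0 hlam'
  exact (hwell lam ⟨hlam0.le, hlam'⟩).abs_iteratedDeriv_three_langer_le (hg lam hlam0 hlam')
    hAa hr0 hrD hrA hlam0 (hlam.trans (min_le_right _ _)) hm hp hVm hVp hxm hxr
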